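/- arXiv:1504.04615 — 5 statements merged into one kernel-verified Lean document; each statement's English description precedes it below -/
import Mathlib

section
/- For the k-user MISO broadcast channel with hybrid CSIT in which exactly one receiver supplies delayed CSIT (|𝒟| = 1), the linear sum-degrees-of-freedom equals LDoF_sum = |𝒫| + 1/2^{|𝒫|}. -/
open MeasureTheory Matrix Filter Topology

noncomputable section

/-- CSIT state of a receiver: instantaneous (`P`), delayed (`D`), or none (`N`). -/
inductive CSITState : Type
  | P : CSITState
  | D : CSITState
  | N : CSITState
  deriving DecidableEq

/-- A channel realization: for each receiver `j`, time slot `t` and transmit antenna `a`,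
the channel coefficient `g j t a`. -/
abbrev Chan (k m n : ℕ) : Type := Fin k → Fin n → Fin m → ℂ

/-- Joint law of the channel coefficients: all entries i.i.d. with common law `μ`. -/
def chanMeasure (k m n : ℕ) (μ : Measure ℂ) : Measure (Chan k m n) :=
  Measure.pi fun _ : Fin k => Measure.pi fun _ : Fin n => Measure.pi fun _ : Fin m => μ

/-- The block-diagonal channel matrix `G_j^n ∈ ℂ^{n × nm}` of a receiver with
channel vectors `g (t) ∈ ℂ^{1 × m}`. -/
def blockDiag {m n : ℕ} (g : Fin n → Fin m → ℂ) : Matrix (Fin n) (Fin n × Fin m) ℂ :=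
  Matrix.of fun t p => if p.1 = t then g t p.2 else 0

/-- A linear coding strategy of block length `n` for the `k`-user MISO BC with `m`
transmit antennas and hybrid CSIT configuration `I`. -/
structure Strategy (k m n : ℕ) (I : Fin k → CSITState) : Type where
  /-- number of information symbols `m_j(n)` for receiver `j` -/
  dim : Fin k → ℕ
  /-- precoding matrix `V_j(t) ∈ ℂ^{m × m_j(n)}`, a function of the channel realization -/
  pre : (j : Fin k) → Fin n → Chan k m n → Matrix (Fin m) (Fin (dim j)) ℂ
  /-- each precoder is a measurable function of the channels -/
  meas : ∀ j t a c, Measurable fun g => pre j t g a c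
  /-- `V_j(t)` depends only on the CSIT available at time `t`: current and past channels of
  receivers with instantaneous CSIT, and strictly past channels of receivers with delayed
  CSIT (and nothing from receivers with no CSIT). -/
  causal : ∀ (j : Fin k) (t : Fin n) (g g' : Chan k m n),
    (∀ i, I i = CSITState.P → ∀ s : Fin n, (s : ℕ) ≤ (t : ℕ) → g i s = g' i s) →
    (∀ i, I i = CSITState.D → ∀ s : Fin n, (s : ℕ) < (t : ℕ) → g i s = g' i s) →
    pre j t g = pre j t g'

namespace Strategy

variable {k m n : ℕ} {I : Fin k → CSITState}

/-- The overall precoding matrix `V_j^n ∈ ℂ^{nm × m_j(n)}` (vertical concatenation of the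
`V_j(t)`). -/
def Vn (f : Strategy k m n I) (j : Fin k) (g : Chan k m n) :
    Matrix (Fin n × Fin m) (Fin (f.dim j)) ℂ :=
  Matrix.of fun r c => f.pre j r.1 g r.2 c

/-- Horizontal concatenation `[∪_{i ∈ S} V_i^n]` of the precoding matrices of the
receivers in `S`. -/
def VS (f : Strategy k m n I) (S : Finset (Fin k)) (g : Chan k m n) :
    Matrix (Fin n × Fin m) ((i : {x // x ∈ S}) × Fin (f.dim i.1)) ℂ :=
  Matrix.of fun r c => f.Vn c.1.1 g r c.2

/-- The received-signal matrix `G_j^n [∪_{i ∈ S} V_i^n]` at receiver `j`. -/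
def recvS (f : Strategy k m n I) (S : Finset (Fin k)) (j : Fin k) (g : Chan k m n) :
    Matrix (Fin n) ((i : {x // x ∈ S}) × Fin (f.dim i.1)) ℂ :=
  blockDiag (g j) * f.VS S g

/-- The received-signal matrix `G_j^n V_j^n` at receiver `j` from its own precoder. -/
def recv1 (f : Strategy k m n I) (j : Fin k) (g : Chan k m n) :
    Matrix (Fin n) (Fin (f.dim j)) ℂ :=
  blockDiag (g j) * f.Vn j g

/-- `G_j^t [∪_{i ∈ S} V_i^t]`: the received signal matrix restricted to the first `t`
time slots (rows beyond `t` set to zero, so that its rank is that of the truncated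
matrix, with the `t = 0` convention of rank `0`). -/
def recvUpTo (f : Strategy k m n I) (S : Finset (Fin k)) (j : Fin k)
    (g : Chan k m n) (t : ℕ) :
    Matrix (Fin n) ((i : {x // x ∈ S}) × Fin (f.dim i.1)) ℂ :=
  Matrix.of fun s c => if (s : ℕ) < t then f.recvS S j g s c else 0

/-- Decodability: for every receiver `j`, almost surely
`rank[G_j^n[∪_i V_i^n]] − rank[G_j^n[∪_{i ≠ j} V_i^n]] = rank[G_j^n V_j^n] = m_j(n)`. -/
def Decodable (f : Strategy k m n I) (μ : Measure ℂ) : Prop :=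
  ∀ j : Fin k, ∀ᵐ g ∂ chanMeasure k m n μ,
    (f.recvS Finset.univ j g).rank - (f.recvS (Finset.univ.erase j) j g).rank
        = (f.recv1 j g).rank ∧
    (f.recv1 j g).rank = f.dim j

end Strategy

/-- A DoF tuple is linearly achievable if there is a sequence of decodable strategies
achieving it in the limit. -/
def LinAchievable (k m : ℕ) (I : Fin k → CSITState) (μ : Measure ℂ) (d : Fin k → ℝ) : Prop :=
  (∀ j, 0 ≤ d j ∧ d j ≤ 1) ∧
  ∃ F : (n : ℕ) → Strategy k m n I,
    (∀ n, (F n).Decodable μ) ∧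
    ∀ j, Tendsto (fun n : ℕ => ((F n).dim j : ℝ) / n) atTop (nhds (d j))

/-- The linear degrees-of-freedom region: closure of the set of linearly achievable tuples. -/
def LDoFRegion (k m : ℕ) (I : Fin k → CSITState) (μ : Measure ℂ) : Set (Fin k → ℝ) :=
  closure {d | LinAchievable k m I μ d}

/-- The linear sum degrees of freedom. -/
def LDoFSum (k m : ℕ) (I : Fin k → CSITState) (μ : Measure ℂ) : ℝ :=
  sSup ((fun d => ∑ j, d j) '' LDoFRegion k m I μ)

/-- The set `𝒫` of receivers supplying instantaneous CSIT. -/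
def stateP (k : ℕ) (I : Fin k → CSITState) : Finset (Fin k) :=
  Finset.univ.filter fun i => I i = CSITState.P

/-- The set `𝒟` of receivers supplying delayed CSIT. -/
def stateD (k : ℕ) (I : Fin k → CSITState) : Finset (Fin k) :=
  Finset.univ.filter fun i => I i = CSITState.D

/-- The set `𝒩` of receivers supplying no CSIT. -/
def stateN (k : ℕ) (I : Fin k → CSITState) : Finset (Fin k) :=
  Finset.univ.filter fun i => I i = CSITState.N


theorem ae_pi_of_forall_ae_update {ι : Type*} [Fintype ι] [DecidableEq ι] {X : ι → Type*}
    [∀ i, MeasurableSpace (X i)] (ν : ∀ i, Measure (X i)) [∀ i, IsProbabilityMeasure (ν i)]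
    (i : ι) {p : (∀ i, X i) → Prop} (hp : MeasurableSet {x | p x})
    (h : ∀ x, ∀ᵐ y ∂ν i, p (Function.update x i y)) : ∀ᵐ x ∂Measure.pi ν, p x := by
  rw [ae_iff]
  change Measure.pi ν {x | p x}ᶜ = 0
  rw [← lintegral_indicator_one hp.compl]
  have hm : Measurable ({x | p x}ᶜ.indicator (1 : (∀ i, X i) → ENNReal)) :=
    measurable_one.indicator hp.compl
  refine (lintegral_eq_of_lmarginal_eq {i} hm measurable_zero ?_).trans lintegral_zero
  ext x
  rw [lmarginal_singleton, lmarginal_singleton]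
  simp only [Pi.zero_apply, lintegral_zero]
  refine (lintegral_eq_zero_iff (hm.comp (measurable_update x))).2 ?_
  filter_upwards [h x] with y hy
  simp [hy]

theorem ae_pi_of_forall_ae_update_single {ι : Type*} [Fintype ι] [DecidableEq ι]
    (μ : Measure ℂ) [IsProbabilityMeasure μ] [NullSingletonClass μ] {ℓ : ι → ℂ} (hℓ : ℓ ≠ 0) :
    ∀ᵐ x ∂Measure.pi fun _ : ι => μ, ∑ a, x a * ℓ a ≠ 0 := by
  obtain ⟨b, hb⟩ := Function.ne_iff.1 hℓ
  refine ae_pi_of_forall_ae_update _ b ?_ fun x => ?_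
  · have : Measurable fun x : ι → ℂ => ∑ a, x a * ℓ a := by fun_prop
    exact (this (measurableSet_singleton 0)).compl
  · have hnull : μ {-(∑ a ∈ Finset.univ.erase b, x a * ℓ a) / ℓ b} = 0 := measure_singleton _
    filter_upwards [compl_mem_ae_iff.2 hnull] with y hy h0
    apply hy
    rw [← Finset.add_sum_erase _ _ (Finset.mem_univ b)] at h0
    rw [Finset.sum_congr rfl fun a ha => by
      rw [Function.update_of_ne (Finset.ne_of_mem_erase ha)]] at h0
    simp only [Function.update_self] at h0
    simp only [Set.mem_singleton_iff]
    rw [eq_div_iff hb]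
    exact eq_neg_of_add_eq_zero_left h0

theorem ae_pi_notMem_submodule {ι : Type*} [Fintype ι] [DecidableEq ι]
    (μ : Measure ℂ) [IsProbabilityMeasure μ] [NullSingletonClass μ] {A : Submodule ℂ (ι → ℂ)} (hA : A ≠ ⊤) :
    ∀ᵐ x ∂Measure.pi fun _ : ι => μ, x ∉ A := by
  obtain ⟨φ, hφ, hAφ⟩ := Submodule.exists_le_ker_of_lt_top A hA.lt_top
  have hsum : ∀ x, φ x = ∑ a, x a * φ (Pi.single a 1) := fun x => by
    conv_lhs => rw [pi_eq_sum_univ' x, map_sum]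
    simp
  have hne : (fun a => φ (Pi.single a 1)) ≠ 0 := fun h0 => hφ <| by
    ext x
    simpa using congrFun h0 x
  filter_upwards [ae_pi_of_forall_ae_update_single μ hne] with x hx hxA
  exact hx ((hsum x).symm.trans (hAφ hxA))

theorem measurableSet_mem_span_range {Ω ι C : Type*} [MeasurableSpace Ω] [Fintype ι] [Fintype C]
    {v : Ω → C → ℂ} {w : ι → Ω → C → ℂ} (hv : Measurable v) (hw : ∀ i, Measurable (w i)) :
    MeasurableSet {x | v x ∈ Submodule.span ℂ (Set.range fun i => w i x)} := by
  have key : {x | v x ∈ Submodule.span ℂ (Set.range fun i => w i x)} =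
      ⋂ N : ℕ, ⋃ q : ℕ, {x | dist (v x) (∑ i, TopologicalSpace.denseSeq (ι → ℂ) q i • w i x)
        < 1 / ((N : ℝ) + 1)} := by
    ext x
    simp only [Set.mem_ofPred_eq, Set.mem_iInter, Set.mem_iUnion]
    constructor
    · intro h N
      obtain ⟨c, hc⟩ := (Submodule.mem_span_range_iff_exists_fun ℂ).1 h
      have hcont : Continuous fun c : ι → ℂ => dist (v x) (∑ i, c i • w i x) := by fun_prop
      have hopen : IsOpen {c : ι → ℂ | dist (v x) (∑ i, c i • w i x) < 1 / ((N : ℝ) + 1)} :=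
        isOpen_lt hcont continuous_const
      exact (TopologicalSpace.denseRange_denseSeq (ι → ℂ)).exists_mem_open hopen
        ⟨c, by simp only [Set.mem_ofPred_eq, hc, dist_self]; positivity⟩
    · intro h
      have hcl : IsClosed (Submodule.span ℂ (Set.range fun i => w i x) : Set (C → ℂ)) :=
        Submodule.closed_of_finiteDimensional _
      rw [← SetLike.mem_coe, ← hcl.closure_eq, Metric.mem_closure_iff]
      intro ε hε
      obtain ⟨N, hN⟩ := exists_nat_one_div_lt hε
      obtain ⟨q, hq⟩ := h N
      exact ⟨_, Submodule.sum_mem _ fun i _ => Submodule.smul_mem _ _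
        (Submodule.subset_span ⟨i, rfl⟩), hq.trans hN⟩
  rw [key]
  refine MeasurableSet.iInter fun N => MeasurableSet.iUnion fun q =>
    measurableSet_lt (hv.dist ?_) measurable_const
  exact Finset.measurable_sum _ fun i _ => (measurable_const_smul _).comp (hw i)

/-- Replace the channel vector of receiver `i` at time `t`. -/
def updateChan {k m n : ℕ} (g : Chan k m n) (i : Fin k) (t : Fin n) (x : Fin m → ℂ) :
    Chan k m n :=
  Function.update g i (Function.update (g i) t x)

theorem updateChan_self {k m n : ℕ} (g : Chan k m n) (i : Fin k) (t : Fin n) (x : Fin m → ℂ) :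
    updateChan g i t x i t = x := by
  simp [updateChan]

theorem updateChan_of_ne {k m n : ℕ} (g : Chan k m n) {i j : Fin k} {t s : Fin n}
    (x : Fin m → ℂ) (h : j ≠ i ∨ s ≠ t) : updateChan g i t x j s = g j s := by
  by_cases hj : j = i
  · subst hj
    simp [updateChan, Function.update_of_ne (h.resolve_left fun h => h rfl)]
  · simp [updateChan, Function.update_of_ne hj]

theorem ae_chan_of_forall_ae_updateChan {k m n : ℕ} (μ : Measure ℂ) [IsProbabilityMeasure μ]
    (i : Fin k) (t : Fin n) {p : Chan k m n → Prop} (hp : MeasurableSet {g | p g})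
    (h : ∀ g, ∀ᵐ x ∂Measure.pi fun _ : Fin m => μ, p (updateChan g i t x)) :
    ∀ᵐ g ∂chanMeasure k m n μ, p g := by
  refine ae_pi_of_forall_ae_update _ i hp fun g => ?_
  refine ae_pi_of_forall_ae_update _ t (measurable_update g hp) fun y => ?_
  filter_upwards [h (Function.update g i y)] with x hx
  simpa [updateChan] using hx

instance chanMeasure.instIsProbabilityMeasure (k m n : ℕ) (μ : Measure ℂ)
    [IsProbabilityMeasure μ] : IsProbabilityMeasure (chanMeasure k m n μ) := by
  unfold chanMeasure; infer_instance

/-- A channel vector which is independent of the vectors `v a` and `w s` is generic: if the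
combination of the `v a` it selects lies in the span of the `w s`, then so do all the `v a`. -/
theorem ae_forall_mem_span_of_sum_mem_span {k m n : ℕ} (μ : Measure ℂ) [IsProbabilityMeasure μ]
    [NullSingletonClass μ] {C ι : Type*} [Fintype C] [Fintype ι] (i : Fin k) (t : Fin n)
    {v : Fin m → Chan k m n → C → ℂ} {w : ι → Chan k m n → C → ℂ}
    (hv : ∀ a, Measurable (v a)) (hw : ∀ s, Measurable (w s))
    (hvu : ∀ a g x, v a (updateChan g i t x) = v a g)
    (hwu : ∀ s g x, w s (updateChan g i t x) = w s g) :
    ∀ᵐ g ∂chanMeasure k m n μ,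
      ∑ a, g i t a • v a g ∈ Submodule.span ℂ (Set.range fun s => w s g) →
        ∀ a, v a g ∈ Submodule.span ℂ (Set.range fun s => w s g) := by
  refine ae_chan_of_forall_ae_updateChan μ i t ?_ fun g => ?_
  · have h1 := measurableSet_mem_span_range (v := fun g : Chan k m n => ∑ a, g i t a • v a g)
      (w := w) (Finset.measurable_sum _ fun a _ => by
        have := hv a
        fun_prop) hw
    have h2 := MeasurableSet.iInter fun a => measurableSet_mem_span_range (hv a) hw
    convert h1.compl.union h2 using 1
    ext g
    simp only [Set.mem_ofPred_eq, Set.mem_union, Set.mem_compl_iff, Set.mem_iInter, imp_iff_not_or]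
  · simp only [hvu, hwu, updateChan_self]
    set W := Submodule.span ℂ (Set.range fun s => w s g)
    by_cases hall : ∀ a, v a g ∈ W
    · exact Eventually.of_forall fun _ _ => hall
    · have hA : W.comap (Fintype.linearCombination ℂ fun a => v a g) ≠ ⊤ := fun htop => by
        refine hall fun a => ?_
        have : Pi.single a (1 : ℂ) ∈ W.comap (Fintype.linearCombination ℂ fun a => v a g) :=
          htop ▸ Submodule.mem_top
        simpa [Fintype.linearCombination_apply_single] using this
      filter_upwards [ae_pi_notMem_submodule μ hA] with x hx hxW
      exact absurd hxW hx

theorem finrank_map_add_finrank_inf_ker {V V' : Type*} [AddCommGroup V] [Module ℂ V]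
    [AddCommGroup V'] [Module ℂ V'] [FiniteDimensional ℂ V] (φ : V →ₗ[ℂ] V')
    (W : Submodule ℂ V) :
    Module.finrank ℂ (W.map φ) + Module.finrank ℂ (W ⊓ LinearMap.ker φ : Submodule ℂ V)
      = Module.finrank ℂ W := by
  have h := (φ.domRestrict W).finrank_range_add_finrank_ker
  rw [LinearMap.range_domRestrict, LinearMap.ker_domRestrict] at h
  rw [← h, ← Submodule.map_comap_subtype, Submodule.finrank_map_subtype_eq]

theorem finrank_map_span_range {ι C C' : Type*} [Finite ι] [Fintype C] [Fintype C']
    (w : ι → C → ℂ) (φ : (C → ℂ) →ₗ[ℂ] C' → ℂ) :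
    (Submodule.span ℂ (Set.range w)).map φ = Submodule.span ℂ (Set.range fun i => φ (w i)) := by
  rw [Submodule.map_span, ← Set.range_comp]; rfl

namespace Strategy

variable {k m n : ℕ} {I : Fin k → CSITState}

/-- The information symbols of all receivers. -/
abbrev Sym (f : Strategy k m n I) : Type := (j : Fin k) × Fin (f.dim j)

/-- The coefficients, with respect to the information symbols, of the signal transmitted by
antenna `a` at time `t`. -/
def sent (f : Strategy k m n I) (t : Fin n) (a : Fin m) (g : Chan k m n) : f.Sym → ℂ :=
  fun c => f.pre c.1 t g a c.2

/-- The coefficients, with respect to the information symbols, of the signal received by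
receiver `j` at time `t`. -/
def row (f : Strategy k m n I) (j : Fin k) (t : Fin n) (g : Chan k m n) : f.Sym → ℂ :=
  ∑ a, g j t a • f.sent t a g

/-- The space of linear combinations of the information symbols known to receiver `j`. -/
def rowSpan (f : Strategy k m n I) (j : Fin k) (g : Chan k m n) : Submodule ℂ (f.Sym → ℂ) :=
  Submodule.span ℂ (Set.range fun t => f.row j t g)

theorem blockDiag_mul_Vn_apply (f : Strategy k m n I) (i j : Fin k) (g : Chan k m n)
    (t : Fin n) (c : Fin (f.dim i)) :
    (blockDiag (g j) * f.Vn i g) t c = f.row j t g ⟨i, c⟩ := by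
  rw [Matrix.mul_apply, Fintype.sum_prod_type, Finset.sum_eq_single t]
  · simp [_root_.blockDiag, Vn, row, sent]
  · intro s _ hs
    simp [_root_.blockDiag, hs]
  · simp

theorem rank_recvS (f : Strategy k m n I) (S : Finset (Fin k)) (j : Fin k) (g : Chan k m n) :
    (f.recvS S j g).rank = Module.finrank ℂ ((f.rowSpan j g).map (LinearMap.funLeft ℂ ℂ
      fun c : (i : {x // x ∈ S}) × Fin (f.dim i.1) => (⟨c.1.1, c.2⟩ : f.Sym))) := by
  rw [Matrix.rank_eq_finrank_span_row, rowSpan, finrank_map_span_range]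
  refine congrArg (fun w => Module.finrank ℂ (Submodule.span ℂ (Set.range w))) ?_
  ext t c
  exact f.blockDiag_mul_Vn_apply c.1.1 j g t c.2

theorem rank_recv1 (f : Strategy k m n I) (j : Fin k) (g : Chan k m n) :
    (f.recv1 j g).rank = Module.finrank ℂ ((f.rowSpan j g).map (LinearMap.funLeft ℂ ℂ
      fun c : Fin (f.dim j) => (⟨j, c⟩ : f.Sym))) := by
  rw [Matrix.rank_eq_finrank_span_row, rowSpan, finrank_map_span_range]
  refine congrArg (fun w => Module.finrank ℂ (Submodule.span ℂ (Set.range w))) ?_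
  ext t c
  exact f.blockDiag_mul_Vn_apply j j g t c

/-- The coefficient vectors involving only the symbols of receiver `j`. -/
def symSpan (f : Strategy k m n I) (j : Fin k) : Submodule ℂ (f.Sym → ℂ) :=
  Submodule.span ℂ (Set.range fun c : Fin (f.dim j) => Pi.single (⟨j, c⟩ : f.Sym) (1 : ℂ))

theorem finrank_symSpan (f : Strategy k m n I) (j : Fin k) :
    Module.finrank ℂ (f.symSpan j) = f.dim j := by
  have h : LinearIndependent ℂ
      fun c : Fin (f.dim j) => Pi.single (M := fun _ => ℂ) (⟨j, c⟩ : f.Sym) (1 : ℂ) :=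
    (Pi.linearIndependent_single_one f.Sym ℂ).comp (fun c : Fin (f.dim j) => (⟨j, c⟩ : f.Sym))
      fun c c' h => by simpa using h
  rw [symSpan, finrank_span_eq_card h, Fintype.card_fin]

theorem mem_symSpan (f : Strategy k m n I) {j : Fin k} {x : f.Sym → ℂ}
    (hx : ∀ c : f.Sym, c.1 ≠ j → x c = 0) : x ∈ f.symSpan j := by
  have hsum : x = ∑ c : Fin (f.dim j), x ⟨j, c⟩ • Pi.single (⟨j, c⟩ : f.Sym) (1 : ℂ) := by
    ext ⟨i, c⟩
    rw [Finset.sum_apply]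
    by_cases hij : i = j
    · subst hij
      rw [Finset.sum_eq_single c]
      · simp
      · intro b _ hb
        simp [hb.symm]
      · simp
    · rw [hx _ hij, Finset.sum_eq_zero]
      intro b _
      simp [hij]
  rw [hsum]
  exact Submodule.sum_mem _ fun c _ => Submodule.smul_mem _ _ (Submodule.subset_span ⟨c, rfl⟩)

theorem funLeft_erase_ker (f : Strategy k m n I) (j : Fin k) :
    LinearMap.ker (LinearMap.funLeft ℂ ℂ
      fun c : (i : {x // x ∈ Finset.univ.erase j}) × Fin (f.dim i.1) => (⟨c.1.1, c.2⟩ : f.Sym))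
      = f.symSpan j := by
  apply le_antisymm
  · intro x hx
    refine f.mem_symSpan fun c hc => ?_
    exact congrFun (LinearMap.mem_ker.1 hx) ⟨⟨c.1, by simpa using hc⟩, c.2⟩
  · rw [symSpan, Submodule.span_le]
    rintro _ ⟨c, rfl⟩
    rw [SetLike.mem_coe, LinearMap.mem_ker]
    ext ⟨⟨i, hi⟩, b⟩
    have : i ≠ j := Finset.ne_of_mem_erase hi
    simp [LinearMap.funLeft_apply, this]

theorem rank_recvS_univ (f : Strategy k m n I) (j : Fin k) (g : Chan k m n) :
    (f.recvS Finset.univ j g).rank = Module.finrank ℂ (f.rowSpan j g) := by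
  have h := finrank_map_add_finrank_inf_ker (LinearMap.funLeft ℂ ℂ
      fun c : (i : {x // x ∈ (Finset.univ : Finset (Fin k))}) × Fin (f.dim i.1) =>
        (⟨c.1.1, c.2⟩ : f.Sym)) (f.rowSpan j g)
  rw [← rank_recvS, LinearMap.ker_eq_bot.2, inf_bot_eq, finrank_bot, add_zero] at h
  · exact h
  · exact LinearMap.funLeft_injective_of_surjective _ _ _ fun c =>
      ⟨⟨⟨c.1, Finset.mem_univ _⟩, c.2⟩, rfl⟩

/-- Decodability, expressed pointwise: the symbols of receiver `j` are known to receiver `j`. -/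
theorem decodable_iff_symSpan_le (f : Strategy k m n I) (j : Fin k) (g : Chan k m n) :
    ((f.recvS Finset.univ j g).rank - (f.recvS (Finset.univ.erase j) j g).rank
        = (f.recv1 j g).rank ∧ (f.recv1 j g).rank = f.dim j) ↔ f.symSpan j ≤ f.rowSpan j g := by
  have h := finrank_map_add_finrank_inf_ker (LinearMap.funLeft ℂ ℂ
      fun c : (i : {x // x ∈ Finset.univ.erase j}) × Fin (f.dim i.1) => (⟨c.1.1, c.2⟩ : f.Sym))
      (f.rowSpan j g)
  rw [← rank_recvS, ← rank_recvS_univ, funLeft_erase_ker] at h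
  rw [← h, Nat.add_sub_cancel_left]
  constructor
  · rintro ⟨h1, h2⟩
    refine inf_eq_right.1 (Submodule.eq_of_le_of_finrank_eq inf_le_right ?_)
    rw [h1, h2, finrank_symSpan]
  · intro hle
    have h2 : (f.recv1 j g).rank = f.dim j := by
      have htop : (f.rowSpan j g).map (LinearMap.funLeft ℂ ℂ
          fun c : Fin (f.dim j) => (⟨j, c⟩ : f.Sym)) = ⊤ := by
        rw [eq_top_iff]
        intro x _
        refine ⟨fun c => if h : c.1 = j then x (h ▸ c.2) else 0, hle (f.mem_symSpan ?_), ?_⟩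
        · intro c hc
          simp [hc]
        · ext c
          simp [LinearMap.funLeft_apply]
      rw [rank_recv1, htop, finrank_top, Module.finrank_fin_fun]
    rw [inf_eq_right.2 hle, finrank_symSpan, h2]
    exact ⟨rfl, rfl⟩

end Strategy

theorem finrank_sup_span_singleton_le {V : Type*} [AddCommGroup V] [Module ℂ V]
    [FiniteDimensional ℂ V] (A : Submodule ℂ V) (v : V) :
    Module.finrank ℂ (A ⊔ Submodule.span ℂ {v} : Submodule ℂ V) ≤ Module.finrank ℂ A + 1 :=
  (Submodule.finrank_add_le_finrank_add_finrank A _).trans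
    (Nat.add_le_add_left (by simpa using finrank_span_le_card (R := ℂ) {v}) _)

theorem finrank_lt_finrank_sup_span_singleton {V : Type*} [AddCommGroup V] [Module ℂ V]
    [FiniteDimensional ℂ V] {A : Submodule ℂ V} {v : V} (hv : v ∉ A) :
    Module.finrank ℂ A < Module.finrank ℂ (A ⊔ Submodule.span ℂ {v} : Submodule ℂ V) := by
  refine Submodule.finrank_lt_finrank_of_lt (left_lt_sup.2 fun h => hv ?_)
  exact h (Submodule.mem_span_singleton_self v)

/-- If `y t` lies in the span of the earlier `x s` whenever `x t` does, then adding the `y t` to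
the `x t` at most doubles the dimension of the span. -/
theorem finrank_span_sup_span_le_two_mul {V : Type*} [AddCommGroup V] [Module ℂ V]
    [FiniteDimensional ℂ V] {n : ℕ} (x y : Fin n → V)
    (h : ∀ t, x t ∈ Submodule.span ℂ (x '' {s | s < t}) →
      y t ∈ Submodule.span ℂ (x '' {s | s < t})) :
    Module.finrank ℂ (Submodule.span ℂ (Set.range x) ⊔ Submodule.span ℂ (Set.range y) :
      Submodule ℂ V) ≤ 2 * Module.finrank ℂ (Submodule.span ℂ (Set.range x)) := by
  have key : ∀ T ≤ n, Module.finrank ℂ (Submodule.span ℂ (x '' {s | (s : ℕ) < T}) ⊔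
      Submodule.span ℂ (y '' {s | (s : ℕ) < T}) : Submodule ℂ V) ≤
      2 * Module.finrank ℂ (Submodule.span ℂ (x '' {s | (s : ℕ) < T})) := by
    intro T
    induction T with
    | zero =>
      have hempty : {s : Fin n | (s : ℕ) < 0} = ∅ := by ext s; simp
      intro _
      rw [hempty, Set.image_empty, Set.image_empty, Submodule.span_empty, sup_bot_eq, finrank_bot]
    | succ T ih =>
      intro hT
      have hset : {s : Fin n | (s : ℕ) < T + 1} = insert ⟨T, hT⟩ {s : Fin n | (s : ℕ) < T} := by
        ext s
        simp only [Set.mem_insert_iff, Set.mem_ofPred_eq, Fin.ext_iff]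
        omega
      have ih := ih (by omega)
      have ht := h ⟨T, hT⟩
      have hset' : {s : Fin n | s < ⟨T, hT⟩} = {s : Fin n | (s : ℕ) < T} := rfl
      rw [hset'] at ht
      rw [hset, Set.image_insert_eq, Set.image_insert_eq, Submodule.span_insert,
        Submodule.span_insert]
      generalize Submodule.span ℂ (x '' {s : Fin n | (s : ℕ) < T}) = A at *
      generalize Submodule.span ℂ (y '' {s : Fin n | (s : ℕ) < T}) = B at *
      have hsup : Submodule.span ℂ {x ⟨T, hT⟩} ⊔ A ⊔ (Submodule.span ℂ {y ⟨T, hT⟩} ⊔ B) =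
          A ⊔ B ⊔ Submodule.span ℂ {x ⟨T, hT⟩} ⊔ Submodule.span ℂ {y ⟨T, hT⟩} := by
        ac_rfl
      rw [hsup, sup_comm _ A]
      by_cases hx : x ⟨T, hT⟩ ∈ A
      · have hy := ht hx
        rw [← Submodule.span_singleton_le_iff_mem] at hx hy
        rwa [sup_eq_left.2 hx, sup_eq_left.2 (hx.trans le_sup_left),
          sup_eq_left.2 (hy.trans le_sup_left)]
      · have h1 := finrank_lt_finrank_sup_span_singleton hx
        have h2 := finrank_sup_span_singleton_le (A ⊔ B) (x ⟨T, hT⟩)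
        have h3 := finrank_sup_span_singleton_le (A ⊔ B ⊔ Submodule.span ℂ {x ⟨T, hT⟩}) (y ⟨T, hT⟩)
        omega
  have := key n le_rfl
  have huniv : {s : Fin n | (s : ℕ) < n} = Set.univ := by ext s; simp
  rwa [huniv, Set.image_univ, Set.image_univ] at this

namespace Strategy

variable {k m n : ℕ} {I : Fin k → CSITState}

/-- The projection onto the symbols of the receivers in `S`. -/
def mask (f : Strategy k m n I) (S : Finset (Fin k)) : (f.Sym → ℂ) →ₗ[ℂ] f.Sym → ℂ :=
  LinearMap.pi fun c => if c.1 ∈ S then LinearMap.proj c else 0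

theorem mask_apply (f : Strategy k m n I) (S : Finset (Fin k)) (x : f.Sym → ℂ) (c : f.Sym) :
    f.mask S x c = if c.1 ∈ S then x c else 0 := by
  unfold mask
  rw [LinearMap.pi_apply]
  split_ifs <;> rfl

theorem measurable_mask (f : Strategy k m n I) (S : Finset (Fin k)) : Measurable (f.mask S) :=
  (LinearMap.continuous_of_finiteDimensional _).measurable

theorem measurable_sent (f : Strategy k m n I) (t : Fin n) (a : Fin m) :
    Measurable (f.sent t a) :=
  measurable_pi_iff.2 fun c => f.meas c.1 t a c.2

theorem measurable_row (f : Strategy k m n I) (j : Fin k) (t : Fin n) :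
    Measurable (f.row j t) := by
  unfold row
  refine Finset.measurable_sum _ fun a _ => ?_
  have := f.measurable_sent t a
  fun_prop

theorem sent_updateChan (f : Strategy k m n I) {i : Fin k} {t s : Fin n} (hP : I i ≠ CSITState.P)
    (hD : I i = CSITState.D → s ≤ t) (a : Fin m) (g : Chan k m n) (x : Fin m → ℂ) :
    f.sent s a (updateChan g i t x) = f.sent s a g := by
  ext c
  unfold sent
  rw [f.causal c.1 s (updateChan g i t x) g]
  · intro j hj s' _
    exact updateChan_of_ne g x (Or.inl fun h => hP (h ▸ hj))
  · intro j hj s' hs'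
    refine updateChan_of_ne g x ?_
    by_cases h : j = i
    · subst h
      exact Or.inr (Fin.ne_of_lt (lt_of_lt_of_le hs' (hD hj)))
    · exact Or.inl h

theorem row_updateChan (f : Strategy k m n I) {i j : Fin k} {t s : Fin n}
    (hP : I i ≠ CSITState.P) (hD : I i = CSITState.D → s ≤ t) (hne : j ≠ i ∨ s ≠ t)
    (g : Chan k m n) (x : Fin m → ℂ) :
    f.row j s (updateChan g i t x) = f.row j s g := by
  simp only [row, f.sent_updateChan hP hD, updateChan_of_ne g x hne]

theorem mask_row (f : Strategy k m n I) (S : Finset (Fin k)) (j : Fin k) (t : Fin n)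
    (g : Chan k m n) : f.mask S (f.row j t g) = ∑ a, g j t a • f.mask S (f.sent t a g) := by
  simp [row, map_sum]

/-- The dimension of the part of the received signal at receiver `j` which originates from the
symbols of the receivers in `S`. -/
def rowRank (f : Strategy k m n I) (j : Fin k) (S : Finset (Fin k)) (g : Chan k m n) : ℕ :=
  Module.finrank ℂ ((f.rowSpan j g).map (f.mask S))

theorem rowRank_eq (f : Strategy k m n I) (j : Fin k) (S : Finset (Fin k)) (g : Chan k m n) :
    f.rowRank j S g =
      Module.finrank ℂ (Submodule.span ℂ (Set.range fun t => f.mask S (f.row j t g))) := by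
  rw [rowRank, rowSpan, finrank_map_span_range]

theorem rowRank_le (f : Strategy k m n I) (j : Fin k) (S : Finset (Fin k)) (g : Chan k m n) :
    f.rowRank j S g ≤ n := by
  refine (Submodule.finrank_map_le _ _).trans ?_
  have := finrank_range_le_card (R := ℂ) fun t => f.row j t g
  rwa [Fintype.card_fin] at this

theorem add_finrank_map_mask_le (f : Strategy k m n I) {j : Fin k} {S : Finset (Fin k)}
    (hj : j ∉ S) {W : Submodule ℂ (f.Sym → ℂ)} (hW : f.symSpan j ≤ W) :
    f.dim j + Module.finrank ℂ (W.map (f.mask S)) ≤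
      Module.finrank ℂ (W.map (f.mask (insert j S))) := by
  have hcomp : (f.mask S) ∘ₗ f.mask (insert j S) = f.mask S := by
    ext x c
    simp only [LinearMap.comp_apply, mask_apply, Finset.mem_insert]
    split_ifs <;> simp_all
  have h := finrank_map_add_finrank_inf_ker (f.mask S) (W.map (f.mask (insert j S)))
  rw [← Submodule.map_comp, hcomp] at h
  have hle : f.symSpan j ≤ W.map (f.mask (insert j S)) ⊓ LinearMap.ker (f.mask S) := by
    have h1 : ∀ x ∈ f.symSpan j, ∀ c : f.Sym, c.1 ≠ j → x c = 0 := by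
      intro x hx c hc
      have : f.symSpan j ≤ LinearMap.ker (LinearMap.proj (R := ℂ) (φ := fun _ => ℂ) c) := by
        rw [symSpan, Submodule.span_le]
        rintro _ ⟨b, rfl⟩
        have : c ≠ ⟨j, b⟩ := fun h => hc (h ▸ rfl)
        simp [this]
      exact this hx
    intro x hx
    refine ⟨⟨x, hW hx, ?_⟩, ?_⟩
    · ext c
      rw [mask_apply, ite_eq_left_iff]
      exact fun hc => (h1 x hx c fun h => hc (h ▸ Finset.mem_insert_self _ _)).symm
    · rw [SetLike.mem_coe, LinearMap.mem_ker]
      ext c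
      rw [mask_apply, Pi.zero_apply, ite_eq_right_iff]
      exact fun hc => h1 x hx c fun h => hj (h ▸ hc)
  have := Submodule.finrank_mono hle
  rw [finrank_symSpan] at this
  omega

theorem ae_two_mul_rowRank_ge (f : Strategy k m n I) (μ : Measure ℂ) [IsProbabilityMeasure μ]
    [NullSingletonClass μ] {d : Fin k} (hd : I d = CSITState.D) {i : Fin k}
    {S : Finset (Fin k)} (hi : i ∉ S) :
    ∀ᵐ g ∂chanMeasure k m n μ, f.symSpan i ≤ f.rowSpan i g →
      f.dim i + f.rowRank d S g ≤ 2 * f.rowRank d (insert i S) g := by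
  have hgen := ae_all_iff.2 fun t : Fin n => ae_forall_mem_span_of_sum_mem_span μ d t
    (v := fun a g => f.mask (insert i S) (f.sent t a g))
    (w := fun (s : {s // s < t}) g => f.mask (insert i S) (f.row d s g))
    (fun a => (f.measurable_mask _).comp (f.measurable_sent t a))
    (fun s => (f.measurable_mask _).comp (f.measurable_row d s))
    (fun a g x => by rw [f.sent_updateChan (by simp [hd]) fun _ => le_rfl])
    (fun s g x => by
      rw [f.row_updateChan (by simp [hd]) (fun _ => s.2.le) (Or.inr (ne_of_lt s.2))])
  filter_upwards [hgen] with g hg hdec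
  have h1 := f.add_finrank_map_mask_le hi (hdec.trans (le_sup_right (a := f.rowSpan d g)))
  have h2 := finrank_span_sup_span_le_two_mul (fun t => f.mask (insert i S) (f.row d t g))
    (fun t => f.mask (insert i S) (f.row i t g)) (by
      intro t ht
      rw [Set.image_eq_range] at ht ⊢
      rw [f.mask_row _ i]
      exact Submodule.sum_mem _ fun a _ => Submodule.smul_mem _ _
        (hg t (by rw [← f.mask_row]; exact ht) a))
  rw [← finrank_map_span_range, ← finrank_map_span_range, ← Submodule.map_sup] at h2
  have h3 : f.rowRank d S g ≤
      Module.finrank ℂ ((f.rowSpan d g ⊔ f.rowSpan i g).map (f.mask S)) :=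
    Submodule.finrank_mono (Submodule.map_mono le_sup_left)
  exact (Nat.add_le_add_left h3 _).trans (h1.trans h2)

theorem ae_rowRank_le_rowRank (f : Strategy k m n I) (μ : Measure ℂ) [IsProbabilityMeasure μ]
    [NullSingletonClass μ] {i : Fin k} (hi : I i = CSITState.N) (j : Fin k)
    (S : Finset (Fin k)) :
    ∀ᵐ g ∂chanMeasure k m n μ, f.rowRank j S g ≤ f.rowRank i S g := by
  rcases eq_or_ne j i with rfl | hji
  · exact Eventually.of_forall fun _ => le_rfl
  let u : Fin n → Fin n → Chan k m n → f.Sym → ℂ := fun t s g =>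
    if s < t then f.mask S (f.row i s g) else f.mask S (f.row j s g)
  have hgen := ae_all_iff.2 fun t : Fin n => ae_forall_mem_span_of_sum_mem_span μ i t
    (v := fun a g => f.mask S (f.sent t a g))
    (w := fun (s : {s // s ≠ t}) g => u t s g)
    (fun a => (f.measurable_mask _).comp (f.measurable_sent t a))
    (fun s => by
      by_cases hs : s.1 < t
      · simp only [u, hs, if_true]
        exact (f.measurable_mask S).comp (f.measurable_row i s)
      · simp only [u, hs, if_false]
        exact (f.measurable_mask S).comp (f.measurable_row j s))
    (fun a g x => by rw [f.sent_updateChan (by simp [hi]) (by simp [hi])])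
    (fun s g x => by
      simp only [u]
      rw [f.row_updateChan (by simp [hi]) (by simp [hi]) (Or.inr s.2),
        f.row_updateChan (by simp [hi]) (by simp [hi]) (Or.inr s.2)])
  filter_upwards [hgen] with g hg
  have key : ∀ T ≤ n, f.rowRank j S g ≤ Module.finrank ℂ (Submodule.span ℂ (Set.range
      fun s : Fin n => if (s : ℕ) < T then f.mask S (f.row i s g) else
        f.mask S (f.row j s g))) := by
    intro T
    induction T with
    | zero =>
      intro _
      rw [rowRank_eq]
      exact le_of_eq rfl
    | succ T ih =>
      intro hT
      refine (ih (by omega)).trans ?_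
      let t : Fin n := ⟨T, hT⟩
      set W := Submodule.span ℂ (Set.range fun s : {s // s ≠ t} => u t s g) with hW
      have hle1 : Submodule.span ℂ (Set.range fun s : Fin n =>
          if (s : ℕ) < T then f.mask S (f.row i s g) else f.mask S (f.row j s g)) ≤
          W ⊔ Submodule.span ℂ {f.mask S (f.row j t g)} := by
        rw [Submodule.span_le]
        rintro _ ⟨s, rfl⟩
        by_cases hs : s = t
        · subst hs
          refine Submodule.mem_sup_right ?_
          simp [t]
        · exact Submodule.mem_sup_left (Submodule.subset_span ⟨⟨s, hs⟩, rfl⟩)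
      have hle2 : W ⊔ Submodule.span ℂ {f.mask S (f.row i t g)} ≤
          Submodule.span ℂ (Set.range fun s : Fin n =>
          if (s : ℕ) < T + 1 then f.mask S (f.row i s g) else f.mask S (f.row j s g)) := by
        rw [sup_le_iff, Submodule.span_le, Submodule.span_singleton_le_iff_mem]
        constructor
        · rintro _ ⟨⟨s, hs⟩, rfl⟩
          refine Submodule.subset_span ⟨s, ?_⟩
          have hs' : (s : ℕ) ≠ T := fun h => hs (Fin.ext h)
          have : (s : ℕ) < T + 1 ↔ s < t := by
            rw [Fin.lt_def]; simp only [t]; omega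
          simp only [this, u]
        · exact Submodule.subset_span ⟨t, by simp [t]⟩
      refine (Submodule.finrank_mono hle1).trans (le_trans ?_ (Submodule.finrank_mono hle2))
      by_cases hx : f.mask S (f.row i t g) ∈ W
      · have hy : f.mask S (f.row j t g) ∈ W := by
          rw [f.mask_row] at hx ⊢
          exact Submodule.sum_mem _ fun a _ => Submodule.smul_mem _ _ (hg t hx a)
        rw [sup_eq_left.2 ((Submodule.span_singleton_le_iff_mem _ _).2 hy)]
        exact Submodule.finrank_mono le_sup_left
      · exact (finrank_sup_span_singleton_le _ _).trans
          (finrank_lt_finrank_sup_span_singleton hx)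
  have := key n le_rfl
  have hif : (fun s : Fin n => if (s : ℕ) < n then f.mask S (f.row i s g) else
      f.mask S (f.row j s g)) = fun s => f.mask S (f.row i s g) :=
    funext fun s => if_pos s.is_lt
  rwa [hif, ← rowRank_eq] at this

theorem sum_dim_le (f : Strategy k m n I) (μ : Measure ℂ) [IsProbabilityMeasure μ]
    [NullSingletonClass μ] (hD : (stateD k I).card = 1) (hf : f.Decodable μ) :
    ((∑ j, f.dim j : ℕ) : ℝ) ≤
      n * ((stateP k I).card + 1 / 2 ^ (stateP k I).card : ℝ) := by
  obtain ⟨d, hd⟩ := Finset.card_eq_one.1 hD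
  have hId : I d = CSITState.D := by
    have : d ∈ stateD k I := hd ▸ Finset.mem_singleton_self d
    simpa [stateD] using this
  have hdec : ∀ᵐ g ∂chanMeasure k m n μ, ∀ j, f.symSpan j ≤ f.rowSpan j g := by
    refine ae_all_iff.2 fun j => ?_
    filter_upwards [hf j] with g hg using (f.decodable_iff_symSpan_le j g).1 hg
  have h1 : ∀ᵐ g ∂chanMeasure k m n μ, ∀ i S, i ∉ S → f.symSpan i ≤ f.rowSpan i g →
      f.dim i + f.rowRank d S g ≤ 2 * f.rowRank d (insert i S) g :=
    ae_all_iff.2 fun i => ae_all_iff.2 fun S => ae_all_iff.2 fun hi =>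
      f.ae_two_mul_rowRank_ge μ hId hi
  have h2 : ∀ᵐ g ∂chanMeasure k m n μ, ∀ i, I i = CSITState.N → ∀ j S,
      f.rowRank j S g ≤ f.rowRank i S g :=
    ae_all_iff.2 fun i => ae_all_iff.2 fun hi => ae_all_iff.2 fun j => ae_all_iff.2 fun S =>
      f.ae_rowRank_le_rowRank μ hi j S
  obtain ⟨g, hdec, h1, h2⟩ := (hdec.and (h1.and h2)).exists
  have hadd : ∀ j S, j ∉ S → f.dim j + f.rowRank j S g ≤ f.rowRank j (insert j S) g :=
    fun j S hj => f.add_finrank_map_mask_le hj (hdec j)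
  have hdim : ∀ j, f.dim j ≤ n := fun j =>
    (Nat.le_add_right _ _).trans ((hadd j ∅ (by simp)).trans (f.rowRank_le _ _ _))
  have hP : ∀ T : Finset (Fin k), ((∑ j ∈ T, f.dim j : ℕ) : ℝ) ≤
      f.rowRank d T g + n * (T.card - 1 + 1 / 2 ^ T.card : ℝ) := by
    intro T
    induction T using Finset.induction_on with
    | empty => simp
    | insert i T hi ih =>
      have h3 : (f.dim i + f.rowRank d T g : ℝ) ≤ 2 * f.rowRank d (insert i T) g := by
        exact_mod_cast h1 i T hi (hdec i)
      have h4 : ((∑ j ∈ insert i T, f.dim j : ℕ) : ℝ) ≤ (T.card + 1) * n := by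
        have := Finset.sum_le_card_nsmul (insert i T) f.dim n fun j _ => hdim j
        rw [Finset.card_insert_of_notMem hi, smul_eq_mul] at this
        exact_mod_cast this
      rw [Finset.sum_insert hi] at h4 ⊢
      rw [Finset.card_insert_of_notMem hi]
      push_cast at h4 ih ⊢
      have h5 : (1 : ℝ) / 2 ^ (T.card + 1) = 1 / 2 ^ T.card / 2 := by
        rw [pow_succ]; field_simp
      rw [h5]
      generalize (1 : ℝ) / 2 ^ T.card = e at *
      nlinarith
  have hdP : d ∉ stateP k I := by simp [stateP, hId]
  have hN : ∀ T ⊆ stateN k I, ∃ j, (∑ i ∈ T, f.dim i) + f.rowRank d (insert d (stateP k I)) g ≤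
      f.rowRank j (T ∪ insert d (stateP k I)) g := by
    intro T
    induction T using Finset.induction_on with
    | empty => exact fun _ => ⟨d, by simp⟩
    | insert i T hi ih =>
      intro hT
      have hiN : I i = CSITState.N := by
        have := hT (Finset.mem_insert_self i T)
        simpa [stateN] using this
      obtain ⟨j, hj⟩ := ih fun x hx => hT (Finset.mem_insert_of_mem hx)
      refine ⟨i, ?_⟩
      have h3 := hadd i (T ∪ insert d (stateP k I)) (by
        have : i ≠ d := fun h => by simp [h, hId] at hiN
        simp [hi, this, stateP, hiN])
      have h4 := h2 i hiN j (T ∪ insert d (stateP k I))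
      rw [Finset.sum_insert hi, Finset.insert_union]
      omega
  obtain ⟨j, hj⟩ := hN _ subset_rfl
  have h3 := hadd d _ hdP
  have h4 := f.rowRank_le j (stateN k I ∪ insert d (stateP k I)) g
  have h5 := hP (stateP k I)
  have hsum : ∑ j, f.dim j =
      ∑ j ∈ stateN k I, f.dim j + (f.dim d + ∑ j ∈ stateP k I, f.dim j) := by
    rw [← Finset.sum_insert hdP, ← Finset.sum_union]
    · congr 1
      ext i
      have : i ∈ stateD k I ↔ i = d := by rw [hd, Finset.mem_singleton]
      simp only [stateD, Finset.mem_filter, Finset.mem_univ, true_and] at this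
      simp only [Finset.mem_univ, stateN, stateP, Finset.mem_union, Finset.mem_filter, true_and,
        Finset.mem_insert, ← this, true_iff]
      cases I i <;> simp
    · rw [Finset.disjoint_left]
      intro i hi hi'
      simp only [stateN, stateP, Finset.mem_filter, Finset.mem_univ, true_and,
        Finset.mem_insert] at hi hi'
      rcases hi' with rfl | hi' <;> simp_all
  rw [hsum]
  have h6 : ((∑ j ∈ stateN k I, f.dim j : ℕ) : ℝ) + (f.dim d + f.rowRank d (stateP k I) g) ≤ n := by
    exact_mod_cast (by omega : (∑ j ∈ stateN k I, f.dim j) +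
      (f.dim d + f.rowRank d (stateP k I) g) ≤ n)
  push_cast at h5 h6 ⊢
  linarith

end Strategy

section CancellationScheme

variable {α : Type*} [DecidableEq α]

/-- The coefficients of the linear combination of the signals received in the slots `B ⊆ A`
in which the symbols of all users `i ∈ A` cancel. -/
def cancelCoeff (c : α → Finset α → ℂ) (A B : Finset α) : ℂ :=
  (if B = A then 1 else 0) - ∑ i : {x // x ∈ A}, c i A * cancelCoeff c (A.erase i) B
termination_by A.card
decreasing_by exact Finset.card_erase_lt_of_mem i.2

theorem cancelCoeff_eq (c : α → Finset α → ℂ) (A B : Finset α) :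
    cancelCoeff c A B =
      (if B = A then 1 else 0) - ∑ i ∈ A, c i A * cancelCoeff c (A.erase i) B := by
  rw [cancelCoeff, ← Finset.sum_coe_sort A]

theorem cancelCoeff_of_not_subset (c : α → Finset α → ℂ) {A B : Finset α} (h : ¬B ⊆ A) :
    cancelCoeff c A B = 0 := by
  induction A using Finset.strongInduction with
  | H A ih =>
    rw [cancelCoeff_eq, if_neg fun hBA => h hBA.subset, Finset.sum_eq_zero, sub_zero]
    intro i hi
    rw [ih _ (Finset.erase_ssubset hi) fun hB => h (hB.trans (Finset.erase_subset _ _)), mul_zero]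

theorem cancelCoeff_self (c : α → Finset α → ℂ) (A : Finset α) : cancelCoeff c A A = 1 := by
  rw [cancelCoeff_eq, if_pos rfl, Finset.sum_eq_zero, sub_zero]
  intro i hi
  rw [cancelCoeff_of_not_subset c fun h => Finset.notMem_erase i A (h hi), mul_zero]

theorem cancelCoeff_congr {c c' : α → Finset α → ℂ} {A : Finset α}
    (h : ∀ i, ∀ B ⊆ A, c i B = c' i B) (B : Finset α) :
    cancelCoeff c A B = cancelCoeff c' A B := by
  induction A using Finset.strongInduction with
  | H A ih =>
    rw [cancelCoeff_eq, cancelCoeff_eq]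
    congr 1
    refine Finset.sum_congr rfl fun i hi => ?_
    rw [h i A subset_rfl, ih _ (Finset.erase_ssubset hi) fun j B hB =>
      h j B (hB.trans (Finset.erase_subset _ _))]

theorem measurable_cancelCoeff {Ω : Type*} [MeasurableSpace Ω] {c : Ω → α → Finset α → ℂ}
    (hc : ∀ i A, Measurable fun ω => c ω i A) (A B : Finset α) :
    Measurable fun ω => cancelCoeff (c ω) A B := by
  induction A using Finset.strongInduction with
  | H A ih =>
    simp only [cancelCoeff_eq _ A]
    exact measurable_const.sub (Finset.measurable_sum _ fun i hi =>
      (hc i A).mul (ih _ (Finset.erase_ssubset hi)))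

variable [Fintype α]

/-- The combination of the symbols of user `i`, indexed by the slots, which the delayed receiver
overhears in a slot `B` with `i ∉ B`, where two fresh symbols of user `i` are sent. -/
def overheard (c : α → Finset α → ℂ) (h : Finset α → ℂ) (i : α) (B : Finset α) : Finset α → ℂ :=
  c i B • Pi.single B 1 + h B • Pi.single (insert i B) 1

/-- The combination of the symbols of user `i` which is sent in a slot `A` with `i ∈ A`. -/
def resent (c : α → Finset α → ℂ) (h : Finset α → ℂ) (i : α) (A : Finset α) : Finset α → ℂ :=
  ∑ B, cancelCoeff c (A.erase i) B • overheard c h i B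

/-- The combination of the symbols of user `i` which the delayed receiver receives in slot `A`. -/
def interference (c : α → Finset α → ℂ) (h : Finset α → ℂ) (i : α) (A : Finset α) :
    Finset α → ℂ :=
  if i ∈ A then c i A • resent c h i A else overheard c h i A

theorem resent_congr {c c' : α → Finset α → ℂ} {h h' : Finset α → ℂ} {i : α} {A : Finset α}
    (hc : ∀ j, ∀ B ⊆ A.erase i, c j B = c' j B) (hh : ∀ B ⊆ A.erase i, h B = h' B) :
    resent c h i A = resent c' h' i A := by
  refine Finset.sum_congr rfl fun B _ => ?_
  by_cases hB : B ⊆ A.erase i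
  · rw [cancelCoeff_congr hc, overheard, overheard, hc i B hB, hh B hB]
  · rw [cancelCoeff_of_not_subset c hB, cancelCoeff_of_not_subset c' hB, zero_smul, zero_smul]

theorem measurable_resent {Ω : Type*} [MeasurableSpace Ω] {c : Ω → α → Finset α → ℂ}
    {h : Ω → Finset α → ℂ} (hc : ∀ i A, Measurable fun ω => c ω i A)
    (hh : ∀ A, Measurable fun ω => h ω A) (i : α) (A X : Finset α) :
    Measurable fun ω => resent (c ω) (h ω) i A X := by
  simp only [resent, overheard, Finset.sum_apply, Pi.smul_apply, Pi.add_apply, smul_eq_mul]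
  refine Finset.measurable_sum _ fun B _ => (measurable_cancelCoeff hc _ _).mul ?_
  exact ((hc i B).mul measurable_const).add ((hh B).mul measurable_const)

theorem sum_cancelCoeff_smul_interference_eq_resent (c : α → Finset α → ℂ) (h : Finset α → ℂ)
    (i : α) (A : Finset α) :
    ∑ B, cancelCoeff c (A.erase i) B • interference c h i B = resent c h i A := by
  refine Finset.sum_congr rfl fun B _ => ?_
  by_cases hB : i ∈ B
  · rw [cancelCoeff_of_not_subset c fun h => Finset.notMem_erase i A (h hB), zero_smul, zero_smul]
  · rw [interference, if_neg hB]

theorem sum_cancelCoeff_smul_interference (c : α → Finset α → ℂ) (h : Finset α → ℂ) {i : α}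
    {A : Finset α} (hi : i ∈ A) : ∑ B, cancelCoeff c A B • interference c h i B = 0 := by
  induction A using Finset.strongInduction with
  | H A ih =>
    simp only [cancelCoeff_eq c A, sub_smul, Finset.sum_sub_distrib, Finset.sum_smul, ite_smul,
      one_smul, zero_smul, Finset.sum_ite_eq', Finset.mem_univ, if_true]
    rw [Finset.sum_comm]
    simp only [mul_smul, ← Finset.smul_sum]
    rw [Finset.sum_eq_single_of_mem i hi, sum_cancelCoeff_smul_interference_eq_resent,
      interference, if_pos hi, sub_self]
    intro j hj hji
    rw [ih _ (Finset.erase_ssubset hj) (Finset.mem_erase.2 ⟨hji.symm, hi⟩), smul_zero]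

/-- A user who receives its fresh symbols in the slots `A` with `i ∉ A` and the resent
combinations in the slots `A` with `i ∈ A` knows all its symbols. -/
theorem single_mem_of_resent_mem {c : α → Finset α → ℂ} {h : Finset α → ℂ} {i : α}
    (hh : ∀ A, h A ≠ 0) {W : Submodule ℂ (Finset α → ℂ)}
    (h1 : ∀ A, i ∉ A → Pi.single A 1 ∈ W) (h2 : ∀ A, i ∈ A → resent c h i A ∈ W)
    (A : Finset α) : Pi.single A 1 ∈ W := by
  induction A using Finset.strongInduction with
  | H A ih =>
    by_cases hi : i ∈ A
    · have hr := h2 A hi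
      rw [resent, ← Finset.add_sum_erase _ _ (Finset.mem_univ (A.erase i)), cancelCoeff_self,
        one_smul, overheard, Finset.insert_erase hi] at hr
      have hsum : ∑ B ∈ Finset.univ.erase (A.erase i),
          cancelCoeff c (A.erase i) B • overheard c h i B ∈ W := by
        refine Submodule.sum_mem _ fun B hB => ?_
        by_cases hBA : B ⊆ A.erase i
        · have hiB : i ∉ B := fun h => Finset.notMem_erase i A (hBA h)
          refine Submodule.smul_mem _ _ (Submodule.add_mem _ (Submodule.smul_mem _ _ (h1 B hiB))
            (Submodule.smul_mem _ _ (ih _ ?_)))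
          refine Finset.ssubset_iff_subset_ne.2 ⟨?_, ?_⟩
          · exact Finset.insert_subset hi (hBA.trans (Finset.erase_subset _ _))
          · rintro rfl
            exact Finset.ne_of_mem_erase hB (Finset.erase_insert hiB).symm
        · rw [cancelCoeff_of_not_subset c hBA, zero_smul]
          exact zero_mem _
      have := (Submodule.add_mem_iff_left _ hsum).1 hr
      have := (Submodule.add_mem_iff_right _
        (Submodule.smul_mem _ _ (h1 _ (Finset.notMem_erase i A)))).1 this
      exact (Submodule.smul_mem_iff _ (hh _)).1 this
    · exact h1 A hi

/-- The slots can be ordered in time compatibly with inclusion. -/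
theorem exists_slot_order (α : Type*) [Fintype α] [DecidableEq α] [LinearOrder α] :
    ∃ (idx : Finset α → ℕ) (slot : ℕ → Finset α), (∀ A, idx A < 2 ^ Fintype.card α) ∧
      (∀ A, slot (idx A) = A) ∧ (∀ s < 2 ^ Fintype.card α, idx (slot s) = s) ∧
      ∀ A B, A ⊂ B → idx A < idx B := by
  let : Fintype (Colex (Finset α)) := inferInstanceAs (Fintype (Finset α))
  have hcard : Fintype.card (Colex (Finset α)) = 2 ^ Fintype.card α := Fintype.card_finset
  let e := Fintype.orderIsoFinOfCardEq (Colex (Finset α)) hcard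
  have hpos : 0 < 2 ^ Fintype.card α := by positivity
  refine ⟨fun A => (e.symm (toColex A) : ℕ),
    fun s => ofColex (e ⟨s % 2 ^ Fintype.card α, Nat.mod_lt _ hpos⟩), fun A => (e.symm _).2,
    fun A => ?_, fun s hs => ?_, fun A B h => ?_⟩
  · simp [Nat.mod_eq_of_lt (e.symm (toColex A)).2]
  · simp [Nat.mod_eq_of_lt hs]
  · exact e.symm.strictMono (Finset.Colex.toColex_lt_toColex_of_ssubset h)

end CancellationScheme

section Beamforming

variable {k m : ℕ}

/-- The matrix whose rows are the channel vectors of the receivers in `S`, completed by unit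
vectors. -/
def beamMatrix (S : Finset (Fin k)) (H : Fin k → Fin m → ℂ) : Matrix (Fin m) (Fin m) ℂ :=
  Matrix.of fun a => if h : (a : ℕ) < k then
    if (⟨a, h⟩ : Fin k) ∈ S then H ⟨a, h⟩ else Pi.single a 1 else Pi.single a 1

/-- A beamforming vector orthogonal to the channel vectors of all receivers in `S` other
than `j`. -/
def beam (hkm : k ≤ m) (S : Finset (Fin k)) (H : Fin k → Fin m → ℂ) (j : Fin k) (a : Fin m) : ℂ :=
  (beamMatrix S H).adjugate a (Fin.castLE hkm j)

theorem beamMatrix_of_mem (hkm : k ≤ m) {S : Finset (Fin k)} {j : Fin k} (hj : j ∈ S)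
    (H : Fin k → Fin m → ℂ) : beamMatrix S H (Fin.castLE hkm j) = H j := by
  ext b
  simp [beamMatrix, Matrix.of_apply, hj]

theorem beamMatrix_of_notMem (hkm : k ≤ m) {S : Finset (Fin k)} {j : Fin k} (hj : j ∉ S)
    (H : Fin k → Fin m → ℂ) :
    beamMatrix S H (Fin.castLE hkm j) = Pi.single (Fin.castLE hkm j) 1 := by
  ext b
  simp [beamMatrix, Matrix.of_apply, hj]

theorem beamMatrix_insert (hkm : k ≤ m) (S : Finset (Fin k)) (j : Fin k) (H : Fin k → Fin m → ℂ) :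
    beamMatrix (insert j S) H = (beamMatrix S H).updateRow (Fin.castLE hkm j) (H j) := by
  ext a b
  by_cases ha : a = Fin.castLE hkm j
  · subst ha
    rw [Matrix.updateRow_self, beamMatrix_of_mem hkm (Finset.mem_insert_self _ _)]
  · rw [Matrix.updateRow_ne ha]
    have : ∀ h : (a : ℕ) < k, (⟨a, h⟩ : Fin k) ≠ j := fun h h' => ha (by ext; simp [← h'])
    simp [beamMatrix, this]

theorem det_beamMatrix_insert (hkm : k ≤ m) (S : Finset (Fin k)) (j : Fin k) (H : Fin k → Fin m → ℂ) :
    (beamMatrix (insert j S) H).det = ∑ a, H j a * beam hkm S H j a := by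
  rw [beamMatrix_insert hkm, ← Matrix.cramer_transpose_apply, Matrix.cramer_eq_adjugate_mulVec,
    Matrix.mulVec, dotProduct, ← Matrix.adjugate_transpose]
  exact Finset.sum_congr rfl fun a _ => mul_comm _ _

theorem sum_mul_beam (hkm : k ≤ m) {S : Finset (Fin k)} {j : Fin k} (hj : j ∈ S) (H : Fin k → Fin m → ℂ)
    (i : Fin k) :
    ∑ a, H j a * beam hkm S H i a = if j = i then (beamMatrix S H).det else 0 := by
  have h := congrFun (congrFun (Matrix.mul_adjugate (beamMatrix S H)) (Fin.castLE hkm j))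
    (Fin.castLE hkm i)
  rw [Matrix.mul_apply] at h
  simp only [beamMatrix_of_mem hkm hj] at h
  simpa [beam, Matrix.one_apply] using h

theorem beam_self (hkm : k ≤ m) {S : Finset (Fin k)} {j : Fin k} (hj : j ∉ S) (H : Fin k → Fin m → ℂ) :
    beam hkm S H j (Fin.castLE hkm j) = (beamMatrix S H).det := by
  have h := congrFun (congrFun (Matrix.mul_adjugate (beamMatrix S H)) (Fin.castLE hkm j))
    (Fin.castLE hkm j)
  rw [Matrix.mul_apply] at h
  simp only [beamMatrix_of_notMem hkm hj] at h
  simpa [beam, Pi.single_apply] using h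

theorem beam_congr (hkm : k ≤ m) {S : Finset (Fin k)} {H H' : Fin k → Fin m → ℂ} (h : ∀ j ∈ S, H j = H' j) :
    beam hkm S H = beam hkm S H' := by
  have : beamMatrix S H = beamMatrix S H' := by
    ext a b
    simp only [beamMatrix, Matrix.of_apply]
    split_ifs with h1 h2
    · rw [h _ h2]
    · rfl
    · rfl
  unfold beam
  rw [this]

theorem continuous_beam (hkm : k ≤ m) (S : Finset (Fin k)) (j : Fin k) (a : Fin m) :
    Continuous fun H : Fin k → Fin m → ℂ => beam hkm S H j a := by
  have h : Continuous fun H : Fin k → Fin m → ℂ => beamMatrix S H := by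
    refine continuous_matrix fun a b => ?_
    simp only [beamMatrix, Matrix.of_apply]
    split_ifs <;> fun_prop
  exact h.matrix_adjugate.matrix_elem _ _

theorem ae_det_beamMatrix_ne_zero (hkm : k ≤ m) {n : ℕ} (μ : Measure ℂ) [IsProbabilityMeasure μ]
    [NullSingletonClass μ] (S : Finset (Fin k)) (t : Fin n) :
    ∀ᵐ g ∂chanMeasure k m n μ, (beamMatrix S fun i => g i t).det ≠ 0 := by
  induction S using Finset.induction_on with
  | empty =>
    refine Eventually.of_forall fun g => ?_
    have : beamMatrix ∅ (fun i => g i t) = 1 := by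
      ext a b
      simp [beamMatrix, Pi.single_apply, Matrix.one_apply, eq_comm]
    simp [this]
  | insert j S hj ih =>
    have hgen := ae_forall_mem_span_of_sum_mem_span μ j t (C := Unit) (ι := Empty)
      (v := fun a g _ => beam hkm S (fun i => g i t) j a) (w := fun e => e.elim)
      (fun a => measurable_pi_iff.2 fun _ =>
        ((continuous_beam hkm S j a).comp (by fun_prop)).measurable) (fun e => e.elim)
      (fun a g x => by
        have h : beam hkm S (fun i => updateChan g j t x i t) = beam hkm S fun i => g i t :=
          beam_congr hkm fun i hi => updateChan_of_ne g x (Or.inl fun h => hj (h ▸ hi))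
        rw [h])
      (fun e => e.elim)
    filter_upwards [hgen, ih] with g hg hdet h0
    rw [det_beamMatrix_insert hkm] at h0
    have hmem := hg (by
      rw [Set.range_eq_empty, Submodule.span_empty, Submodule.mem_bot]
      ext
      simpa using h0) (Fin.castLE hkm j)
    rw [Set.range_eq_empty, Submodule.span_empty, Submodule.mem_bot] at hmem
    exact hdet ((beam_self hkm hj _).symm.trans (congrFun hmem ()))

end Beamforming

section Scheme

variable {k m n : ℕ}

/-- The receivers with instantaneous CSIT. -/
abbrev PUser (I : Fin k → CSITState) : Type := {i : Fin k // I i = CSITState.P}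

/-- The position in time of the slot `A` within a block. -/
def slotIdx {I : Fin k → CSITState} : Finset (PUser I) → ℕ :=
  (exists_slot_order (PUser I)).choose

/-- The slot at position `s` of a block. -/
def slotAt {I : Fin k → CSITState} : ℕ → Finset (PUser I) :=
  (exists_slot_order (PUser I)).choose_spec.choose

/-- The number of slots of a block. -/
def blockLen (I : Fin k → CSITState) : ℕ :=
  2 ^ Fintype.card (PUser I)

theorem blockLen_pos (I : Fin k → CSITState) : 0 < blockLen I :=
  Nat.two_pow_pos _

theorem blockLen_eq (I : Fin k → CSITState) : blockLen I = 2 ^ (stateP k I).card := by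
  rw [blockLen, Fintype.card_subtype, stateP]

variable {I : Fin k → CSITState}

theorem slotIdx_lt (A : Finset (PUser I)) : slotIdx A < blockLen I :=
  (exists_slot_order (PUser I)).choose_spec.choose_spec.1 A

theorem slotAt_slotIdx (A : Finset (PUser I)) : slotAt (slotIdx A) = A :=
  (exists_slot_order (PUser I)).choose_spec.choose_spec.2.1 A

theorem slotIdx_slotAt {s : ℕ} (hs : s < blockLen I) : slotIdx (slotAt s : Finset (PUser I)) = s :=
  (exists_slot_order (PUser I)).choose_spec.choose_spec.2.2.1 s hs

theorem slotIdx_lt_slotIdx {A B : Finset (PUser I)} (h : A ⊂ B) : slotIdx A < slotIdx B :=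
  (exists_slot_order (PUser I)).choose_spec.choose_spec.2.2.2 A B h

/-- The time of slot `A` of block `β`. -/
def slotTime (β : ℕ) (A : Finset (PUser I)) : ℕ :=
  β * blockLen I + slotIdx A

theorem slotTime_div (β : ℕ) (A : Finset (PUser I)) : slotTime β A / blockLen I = β := by
  rw [slotTime, mul_comm, Nat.mul_add_div (blockLen_pos I), Nat.div_eq_of_lt (slotIdx_lt A),
    add_zero]

theorem slotTime_mod (β : ℕ) (A : Finset (PUser I)) :
    slotTime β A % blockLen I = slotIdx A := by
  rw [slotTime, mul_comm, Nat.mul_add_mod, Nat.mod_eq_of_lt (slotIdx_lt A)]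

theorem slotTime_slotAt (t : ℕ) :
    slotTime (t / blockLen I) (slotAt (t % blockLen I) : Finset (PUser I)) = t := by
  rw [slotTime, slotIdx_slotAt (Nat.mod_lt _ (blockLen_pos I)), Nat.div_add_mod']

theorem slotTime_lt {β : ℕ} (hβ : β < n / blockLen I) (A : Finset (PUser I)) :
    slotTime β A < n := by
  calc slotTime β A < (β + 1) * blockLen I := by
        rw [slotTime, add_mul, one_mul]
        exact Nat.add_lt_add_left (slotIdx_lt A) _
    _ ≤ n / blockLen I * blockLen I := Nat.mul_le_mul_right _ hβ
    _ ≤ n := Nat.div_mul_le_self _ _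

/-- The channel vectors at time `s`. -/
def chanAt (g : Chan k m n) (s : ℕ) (i : Fin k) (a : Fin m) : ℂ :=
  if h : s < n then g i ⟨s, h⟩ a else 0

theorem chanAt_val (g : Chan k m n) (t : Fin n) : chanAt g t = fun i => g i t := by
  ext i a
  simp [chanAt]

theorem measurable_chanAt (s : ℕ) : Measurable fun g : Chan k m n => chanAt g s := by
  refine measurable_pi_iff.2 fun i => measurable_pi_iff.2 fun a => ?_
  unfold chanAt
  split_ifs <;> fun_prop

/-- The coefficient with which receiver `d` hears, in slot `A` of block `β`, the signal
beamformed to receiver `i`. -/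
def link (hkm : k ≤ m) (d : Fin k) (g : Chan k m n) (β : ℕ) (i : Fin k)
    (A : Finset (PUser I)) : ℂ :=
  ∑ a, chanAt g (slotTime β A) d a * beam hkm (stateP k I) (chanAt g (slotTime β A)) i a

theorem measurable_link (hkm : k ≤ m) (d : Fin k) (β : ℕ) (i : Fin k) (A : Finset (PUser I)) :
    Measurable fun g : Chan k m n => link hkm d g β i A := by
  refine Finset.measurable_sum _ fun a _ => ?_
  exact ((measurable_chanAt _).eval.eval).mul
    ((continuous_beam hkm _ i a).measurable.comp (measurable_chanAt _))

/-- The combination of the symbols of user `i`, indexed by the slots, which user `i` receives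
in slot `A` of block `β`. -/
def wanted (hkm : k ≤ m) (d : Fin k) (g : Chan k m n) (β : ℕ) (i : PUser I)
    (A : Finset (PUser I)) : Finset (PUser I) → ℂ :=
  if i ∈ A then resent (fun j => link hkm d g β j) (link hkm d g β d) i A else Pi.single A 1

/-- The precoder of the symbols of user `i` with instantaneous CSIT, where slot `A` of
block `β` takes place at the time under consideration. -/
def userPre (hkm : k ≤ m) (d : Fin k) (g : Chan k m n) (β : ℕ) (A : Finset (PUser I))
    (i : PUser I) (a : Fin m) (X : Finset (PUser I)) : ℂ :=
  beam hkm (stateP k I) (chanAt g (slotTime β A)) i a * wanted hkm d g β i A X +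
    if i ∈ A then 0 else beam hkm (stateP k I) (chanAt g (slotTime β A)) d a *
      (Pi.single (insert i A) 1 : Finset (PUser I) → ℂ) X

/-- The precoder of the symbol with index `c` of receiver `j` in slot `A` of block `β`. -/
def schemePre (hkm : k ≤ m) (d : Fin k) (g : Chan k m n) (β : ℕ) (A : Finset (PUser I))
    (j : Fin k) (a : Fin m) (c : ℕ) : ℂ :=
  if h : I j = CSITState.P then
    if β = c / blockLen I then userPre hkm d g β A ⟨j, h⟩ a (slotAt (c % blockLen I)) else 0
  else if β = c ∧ A = Finset.univ then beam hkm (stateP k I) (chanAt g (slotTime β A)) d a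
  else 0

theorem measurable_schemePre (hkm : k ≤ m) (d : Fin k) (β : ℕ) (A : Finset (PUser I))
    (j : Fin k) (a : Fin m) (c : ℕ) :
    Measurable fun g : Chan k m n => schemePre hkm d g β A j a c := by
  have hbeam : ∀ i, Measurable fun g : Chan k m n =>
      beam hkm (stateP k I) (chanAt g (slotTime β A)) i a := fun i =>
    (continuous_beam hkm _ i a).measurable.comp (measurable_chanAt _)
  have hres : ∀ (i : PUser I) X, Measurable fun g : Chan k m n =>
      resent (fun j : PUser I => link hkm d g β j) (link hkm d g β d) i A X := fun i X =>
    measurable_resent (α := PUser I) (fun j B => measurable_link hkm d β j B)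
      (fun B => measurable_link hkm d β d B) i A X
  unfold schemePre userPre wanted
  split_ifs with h1 h2 h3 h4
  · exact ((hbeam _).mul (hres _ _)).add measurable_const
  · exact ((hbeam _).mul measurable_const).add ((hbeam _).mul measurable_const)
  · exact measurable_const
  · exact hbeam _
  · exact measurable_const

theorem schemePre_congr (hkm : k ≤ m) {d : Fin k} (hd : I d = CSITState.D) {g g' : Chan k m n}
    {β : ℕ} {A : Finset (PUser I)}
    (hP : ∀ i, I i = CSITState.P → ∀ s : Fin n, (s : ℕ) ≤ slotTime β A → g i s = g' i s)
    (hD : ∀ i, I i = CSITState.D → ∀ s : Fin n, (s : ℕ) < slotTime β A → g i s = g' i s) :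
    (schemePre hkm d g β A : Fin k → Fin m → ℕ → ℂ) = schemePre hkm d g' β A := by
  have hbeam : ∀ B : Finset (PUser I), slotTime β B ≤ slotTime β A →
      beam hkm (stateP k I) (chanAt g (slotTime β B)) =
        beam hkm (stateP k I) (chanAt g' (slotTime β B)) := by
    refine fun B hB => beam_congr hkm fun j hj => ?_
    ext a
    unfold chanAt
    split_ifs with h
    · rw [hP j (by simpa [stateP] using hj) _ hB]
    · rfl
  have hlink : ∀ i, ∀ B : Finset (PUser I), slotTime β B < slotTime β A →
      link hkm d g β i B = link hkm d g' β i B := by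
    intro i B hB
    have : chanAt g (slotTime β B) d = chanAt g' (slotTime β B) d := by
      ext a
      unfold chanAt
      split_ifs with h
      · rw [hD d hd _ hB]
      · rfl
    rw [link, link, hbeam B hB.le, this]
  have hwanted : ∀ i, wanted hkm d g β i A = wanted hkm d g' β i A := by
    intro i
    unfold wanted
    split_ifs with hi
    · have hlt : ∀ B ⊆ A.erase i, slotTime β B < slotTime β A := fun B hB =>
        Nat.add_lt_add_left (slotIdx_lt_slotIdx (hB.trans_ssubset (Finset.erase_ssubset hi))) _
      exact resent_congr (fun j B hB => hlink j B (hlt B hB)) fun B hB => hlink d B (hlt B hB)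
    · rfl
  ext j a c
  unfold schemePre userPre
  simp only [hbeam A le_rfl, hwanted]

/-- In each block, receiver `d` gets one symbol and the receivers with instantaneous CSIT get one
symbol per slot. -/
def scheme (hkm : k ≤ m) (n : ℕ) {d : Fin k} (hd : I d = CSITState.D) : Strategy k m n I where
  dim j := if I j = CSITState.P then n / blockLen I * blockLen I else
    if j = d then n / blockLen I else 0
  pre j t g := Matrix.of fun a c =>
    schemePre hkm d g (t / blockLen I) (slotAt (t % blockLen I)) j a c
  meas j t a c := measurable_schemePre hkm d _ _ j a c
  causal j t g g' hP hD := by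
    rw [schemePre_congr hkm hd]
    · rwa [slotTime_slotAt]
    · rwa [slotTime_slotAt]

theorem scheme_row (hkm : k ≤ m) {d : Fin k} (hd : I d = CSITState.D) {g : Chan k m n} {β : ℕ}
    (A : Finset (PUser I)) (ht : slotTime β A < n) (j : Fin k) (c : (scheme hkm n hd).Sym) :
    (scheme hkm n hd).row j ⟨slotTime β A, ht⟩ g c =
      ∑ a, chanAt g (slotTime β A) j a * schemePre hkm d g β A c.1 a c.2 := by
  rw [Strategy.row, Finset.sum_apply]
  refine Finset.sum_congr rfl fun a _ => ?_
  change g j ⟨slotTime β A, ht⟩ a * schemePre hkm d g (slotTime β A / blockLen I)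
    (slotAt (slotTime β A % blockLen I)) c.1 a c.2 = _
  rw [slotTime_div, slotTime_mod, slotAt_slotIdx, chanAt, dif_pos ht]

theorem sum_mul_userPre_of_mem (hkm : k ≤ m) {d : Fin k} (hd : I d = CSITState.D)
    (g : Chan k m n) (β : ℕ) (A : Finset (PUser I)) (j i : PUser I) (X : Finset (PUser I)) :
    ∑ a, chanAt g (slotTime β A) j a * userPre hkm d g β A i a X =
      if j = i then (beamMatrix (stateP k I) (chanAt g (slotTime β A))).det *
        wanted hkm d g β i A X else 0 := by
  have hj : (j : Fin k) ∈ stateP k I := by simp [stateP, j.2]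
  have hjd : (j : Fin k) ≠ d := fun h => by simpa [h, hd] using j.2
  have h1 := sum_mul_beam hkm hj (chanAt g (slotTime β A))
  have h2 := h1 d
  rw [if_neg hjd] at h2
  unfold userPre
  simp only [mul_add, Finset.sum_add_distrib, ← mul_assoc, ← Finset.sum_mul, h1, mul_ite, mul_zero]
  split_ifs <;> simp_all [Subtype.ext_iff, ← Finset.sum_mul]

theorem sum_mul_userPre_delayed (hkm : k ≤ m) (d : Fin k)
    (g : Chan k m n) (β : ℕ) (A : Finset (PUser I)) (i : PUser I) (X : Finset (PUser I)) :
    ∑ a, chanAt g (slotTime β A) d a * userPre hkm d g β A i a X =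
      interference (fun j : PUser I => link hkm d g β j) (link hkm d g β d) i A X := by
  unfold userPre wanted interference
  split_ifs with hi
  · simp only [add_zero, ← mul_assoc, ← Finset.sum_mul]
    rfl
  · simp only [mul_add, Finset.sum_add_distrib, ← mul_assoc, ← Finset.sum_mul]
    rfl

/-- The coefficient vector of a combination of the symbols of receiver `j` in block `β`. -/
def blockEmb (f : Strategy k m n I) (j : Fin k) (β : ℕ) :
    (Finset (PUser I) → ℂ) →ₗ[ℂ] f.Sym → ℂ where
  toFun x s := if s.1 = j ∧ β = s.2 / blockLen I then x (slotAt (s.2 % blockLen I)) else 0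
  map_add' x y := by
    ext s
    simp only [Pi.add_apply]
    split_ifs <;> simp
  map_smul' r x := by
    ext s
    simp only [Pi.smul_apply, RingHom.id_apply]
    split_ifs <;> simp

theorem blockEmb_single (f : Strategy k m n I) (j : Fin k) (c : Fin (f.dim j)) :
    blockEmb f j (c / blockLen I) (Pi.single (slotAt (c % blockLen I)) 1) =
      Pi.single (⟨j, c⟩ : f.Sym) 1 := by
  ext ⟨i, e⟩
  simp only [blockEmb, LinearMap.coe_mk, AddHom.coe_mk, Pi.single_apply, Sigma.mk.injEq]
  by_cases hij : i = j
  · subst hij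
    have hK := blockLen_pos I
    have : ((c : ℕ) / blockLen I = e / blockLen I ∧
        (slotAt (e % blockLen I) : Finset (PUser I)) = slotAt (c % blockLen I)) ↔ e = c := by
      constructor
      · rintro ⟨h1, h2⟩
        have h3 := congrArg slotIdx h2
        rw [slotIdx_slotAt (Nat.mod_lt _ hK), slotIdx_slotAt (Nat.mod_lt _ hK)] at h3
        ext
        rw [← Nat.div_add_mod e (blockLen I), ← Nat.div_add_mod c (blockLen I), h1, h3]
      · rintro rfl
        exact ⟨rfl, rfl⟩
    simp only [true_and, ← ite_and]
    exact if_congr (this.trans (by simp)) rfl rfl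
  · simp [hij]

theorem scheme_row_instantaneous (hkm : k ≤ m) {d : Fin k} (hd : I d = CSITState.D)
    {g : Chan k m n} {β : ℕ} (A : Finset (PUser I)) (ht : slotTime β A < n) (j : PUser I) :
    (scheme hkm n hd).row j ⟨slotTime β A, ht⟩ g =
      (beamMatrix (stateP k I) (chanAt g (slotTime β A))).det •
        blockEmb (scheme hkm n hd) j β (wanted hkm d g β j A) := by
  ext ⟨i, e⟩
  rw [scheme_row]
  simp only [schemePre, blockEmb, LinearMap.coe_mk, AddHom.coe_mk, Pi.smul_apply, smul_eq_mul]
  have hjd : (j : Fin k) ≠ d := fun h => by simpa [h, hd] using j.2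
  have hj : (j : Fin k) ∈ stateP k I := by simp [stateP, j.2]
  by_cases hi : I i = CSITState.P
  · simp only [hi, dif_pos]
    by_cases hβ : β = e / blockLen I
    · simp only [hβ, and_true, if_true]
      rw [sum_mul_userPre_of_mem hkm hd]
      by_cases hij : i = j
      · subst hij
        simp
      · rw [if_neg fun h => hij (congrArg Subtype.val h).symm, if_neg hij, mul_zero]
    · simp [hβ]
  · have hij : i ≠ j := fun h => hi (h ▸ j.2)
    simp only [hi, dif_neg, not_false_eq_true, hij, false_and, if_false, mul_zero]
    split_ifs
    · rw [sum_mul_beam hkm hj, if_neg hjd]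
    · simp

theorem scheme_row_delayed (hkm : k ≤ m) {d : Fin k} (hd : I d = CSITState.D)
    {g : Chan k m n} {β : ℕ} (ht : ∀ A : Finset (PUser I), slotTime β A < n)
    (c : Fin ((scheme hkm n hd).dim d)) (hc : β = c) :
    ∑ A, cancelCoeff (fun j : PUser I => link hkm d g β j) Finset.univ A •
      (scheme hkm n hd).row d ⟨slotTime β A, ht A⟩ g =
      link hkm d g β d (Finset.univ : Finset (PUser I)) •
        Pi.single (⟨d, c⟩ : (scheme hkm n hd).Sym) 1 := by
  ext ⟨i, e⟩
  rw [Finset.sum_apply]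
  simp only [Pi.smul_apply, scheme_row, smul_eq_mul, schemePre]
  by_cases hi : I i = CSITState.P
  · have hid : i ≠ d := fun h => by simp [h, hd] at hi
    simp only [hi, dif_pos]
    split_ifs with h1
    · simp only [sum_mul_userPre_delayed]
      have := congrFun (sum_cancelCoeff_smul_interference (fun j : PUser I => link hkm d g β j)
        (link hkm d g β d) (Finset.mem_univ ⟨i, hi⟩)) (slotAt (e % blockLen I))
      rw [Finset.sum_apply] at this
      simpa [hid] using this
    · simp [hid]
  · simp only [hi, dif_neg, not_false_eq_true]
    have hid : i = d := by
      by_contra hid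
      have := e.2
      simp [scheme, hi, hid] at this
    subst hid
    rw [Finset.sum_eq_single_of_mem Finset.univ (Finset.mem_univ _), cancelCoeff_self, one_mul]
    · by_cases he : e = c
      · subst he
        simp [hc, link]
      · have : β ≠ e := fun h => he (Fin.ext (h.symm.trans hc))
        simp [he, this]
    · intro A _ hA
      simp [hA]

theorem scheme_symSpan_le_rowSpan (hkm : k ≤ m) {d : Fin k} (hd : I d = CSITState.D)
    {g : Chan k m n} (h1 : ∀ t, (beamMatrix (stateP k I) fun i => g i t).det ≠ 0)
    (h2 : ∀ t, (beamMatrix (insert d (stateP k I)) fun i => g i t).det ≠ 0) (j : Fin k) :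
    (scheme hkm n hd).symSpan j ≤ (scheme hkm n hd).rowSpan j g := by
  have hrow : ∀ t, (scheme hkm n hd).row j t g ∈ (scheme hkm n hd).rowSpan j g := fun t =>
    Submodule.subset_span ⟨t, rfl⟩
  have hlink : ∀ β < n / blockLen I, ∀ A : Finset (PUser I), link hkm d g β d A ≠ 0 := by
    intro β hβ A
    have := h2 ⟨_, slotTime_lt hβ A⟩
    rwa [← chanAt_val, det_beamMatrix_insert hkm] at this
  refine Submodule.span_le.2 (Set.range_subset_iff.2 fun c => ?_)
  rw [SetLike.mem_coe]
  have hc : (c : ℕ) < if I j = CSITState.P then n / blockLen I * blockLen I else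
    if j = d then n / blockLen I else 0 := c.2
  by_cases hj : I j = CSITState.P
  · rw [if_pos hj] at hc
    have hβ : (c : ℕ) / blockLen I < n / blockLen I :=
      (Nat.div_lt_iff_lt_mul (blockLen_pos I)).2 hc
    have hwanted : ∀ A, wanted hkm d g (c / blockLen I) ⟨j, hj⟩ A ∈
        ((scheme hkm n hd).rowSpan j g).comap
          (blockEmb (scheme hkm n hd) j (c / blockLen I)) := by
      intro A
      have hdet := h1 ⟨_, slotTime_lt hβ A⟩
      rw [← chanAt_val] at hdet
      have h := hrow ⟨_, slotTime_lt hβ A⟩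
      rw [scheme_row_instantaneous hkm hd A _ ⟨j, hj⟩] at h
      exact Submodule.mem_comap.2 ((Submodule.smul_mem_iff _ hdet).1 h)
    have h := single_mem_of_resent_mem (i := (⟨j, hj⟩ : PUser I)) (hlink _ hβ)
      (W := ((scheme hkm n hd).rowSpan j g).comap
        (blockEmb (scheme hkm n hd) j (c / blockLen I)))
      (fun A hA => by simpa [wanted, hA] using hwanted A)
      (fun A hA => by
        have := hwanted A
        rwa [wanted, if_pos hA] at this) (slotAt (c % blockLen I))
    rwa [Submodule.mem_comap, blockEmb_single] at h
  · rw [if_neg hj] at hc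
    by_cases hjd : j = d
    · rw [if_pos hjd] at hc
      subst hjd
      refine (Submodule.smul_mem_iff _ (hlink _ hc Finset.univ)).1 ?_
      rw [← scheme_row_delayed hkm hd (fun A => slotTime_lt hc A) c rfl]
      exact Submodule.sum_mem _ fun A _ => Submodule.smul_mem _ _ (hrow _)
    · rw [if_neg hjd] at hc
      exact absurd hc (Nat.not_lt_zero _)

theorem decodable_scheme (hkm : k ≤ m) (μ : Measure ℂ) [IsProbabilityMeasure μ]
    [NullSingletonClass μ] {d : Fin k} (hd : I d = CSITState.D) :
    (scheme hkm n hd).Decodable μ := by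
  intro j
  filter_upwards [ae_all_iff.2 fun t => ae_det_beamMatrix_ne_zero hkm μ (stateP k I) t,
    ae_all_iff.2 fun t => ae_det_beamMatrix_ne_zero hkm μ (insert d (stateP k I)) t] with g h1 h2
  exact (Strategy.decodable_iff_symSpan_le _ j g).2 (scheme_symSpan_le_rowSpan hkm hd h1 h2 j)

end Scheme

section SumDoF

variable {k m : ℕ} {I : Fin k → CSITState}

theorem linAchievable_scheme (hkm : k ≤ m) (μ : Measure ℂ) [IsProbabilityMeasure μ]
    [NullSingletonClass μ] {d : Fin k} (hd : I d = CSITState.D) :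
    LinAchievable k m I μ fun j => if I j = CSITState.P then 1 else
      if j = d then 1 / 2 ^ (stateP k I).card else 0 := by
  have hK : (0 : ℝ) < blockLen I := Nat.cast_pos.2 (blockLen_pos I)
  have hcast : ((blockLen I : ℕ) : ℝ) = 2 ^ (stateP k I).card := by
    rw [blockLen_eq, Nat.cast_pow, Nat.cast_ofNat]
  have hone : 1 / (2 : ℝ) ^ (stateP k I).card ≤ 1 :=
    div_le_one_of_le₀ (one_le_pow₀ one_le_two) (by positivity)
  have hlim : Tendsto (fun n : ℕ => ((n / blockLen I : ℕ) : ℝ) / n) atTop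
      (𝓝 (1 / 2 ^ (stateP k I).card)) := by
    have h := (tendsto_nat_floor_mul_div_atTop (R := ℝ) (a := 1 / 2 ^ (stateP k I).card)
      (by positivity)).comp tendsto_natCast_atTop_atTop
    refine h.congr fun n => ?_
    rw [Function.comp_apply, ← hcast, one_div_mul_eq_div, Nat.floor_div_natCast, Nat.floor_natCast]
  refine ⟨fun j => ?_, fun n => scheme hkm n hd, fun n => decodable_scheme hkm μ hd, fun j => ?_⟩
  · dsimp only
    split_ifs
    · norm_num
    · exact ⟨by positivity, hone⟩
    · norm_num
  · simp only [scheme]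
    split_ifs
    · have h := hlim.mul_const (blockLen I : ℝ)
      rw [hcast, one_div_mul_cancel (by positivity)] at h
      refine h.congr fun n => ?_
      rw [Nat.cast_mul, hcast]
      ring
    · exact hlim
    · simp

theorem LinAchievable.sum_le {μ : Measure ℂ} [IsProbabilityMeasure μ] [NullSingletonClass μ]
    (hD : (stateD k I).card = 1) {d : Fin k → ℝ} (h : LinAchievable k m I μ d) :
    ∑ j, d j ≤ (stateP k I).card + 1 / 2 ^ (stateP k I).card := by
  obtain ⟨-, F, hdec, hlim⟩ := h
  refine le_of_tendsto (tendsto_finsetSum Finset.univ fun j _ => hlim j) ?_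
  filter_upwards [eventually_gt_atTop 0] with n hn
  rw [← Finset.sum_div, div_le_iff₀ (Nat.cast_pos.2 hn), mul_comm]
  exact_mod_cast (F n).sum_dim_le μ hD (hdec n)

end SumDoF

/-- **Proposition 2.** If exactly one receiver supplies delayed CSIT, then
`LDoF_sum = |𝒫| + 1/2^{|𝒫|}`. -/
theorem ldof_sum_single_delayed (k m : ℕ) (hkm : k ≤ m) (I : Fin k → CSITState)
    (μ : Measure ℂ) [IsProbabilityMeasure μ] (hac : μ ≪ (volume : Measure ℂ))
    (hD : (stateD k I).card = 1) :
    LDoFSum k m I μ = ((stateP k I).card : ℝ) + 1 / 2 ^ ((stateP k I).card) := by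
  have : NullSingletonClass μ := ⟨fun x => hac (measure_singleton x)⟩
  obtain ⟨d, hd⟩ := Finset.card_eq_one.1 hD
  have hdD : I d = CSITState.D := by
    have : d ∈ stateD k I := hd ▸ Finset.mem_singleton_self d
    simpa [stateD] using this
  have hbound : ∀ x ∈ (fun d => ∑ j, d j) '' LDoFRegion k m I μ,
      x ≤ ((stateP k I).card : ℝ) + 1 / 2 ^ (stateP k I).card := by
    rintro _ ⟨y, hy, rfl⟩
    refine closure_minimal (t := {d : Fin k → ℝ | ∑ j, d j ≤ _})
      (fun d h => LinAchievable.sum_le hD h)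
      (isClosed_le (by fun_prop) continuous_const) hy
  have hmem := Set.mem_image_of_mem (fun d : Fin k → ℝ => ∑ j, d j)
    (subset_closure (linAchievable_scheme hkm μ hdD) : _ ∈ LDoFRegion k m I μ)
  have hsum : (∑ j, if I j = CSITState.P then (1 : ℝ) else
      if j = d then 1 / 2 ^ (stateP k I).card else 0) =
        (stateP k I).card + 1 / 2 ^ (stateP k I).card := by
    have : ∀ j, (if I j = CSITState.P then (1 : ℝ) else
        if j = d then 1 / 2 ^ (stateP k I).card else 0) =
          (if I j = CSITState.P then 1 else 0) + if j = d then 1 / 2 ^ (stateP k I).card else 0 := by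
      intro j
      by_cases hj : j = d
      · subst hj
        simp [hdD]
      · simp [hj]
    simp only [this, Finset.sum_add_distrib, Finset.sum_boole, Finset.sum_ite_eq',
      Finset.mem_univ, if_true]
    rfl
  rw [LDoFSum]
  refine le_antisymm (csSup_le ⟨_, hmem⟩ hbound) ?_
  rw [← hsum]
  exact le_csSup ⟨_, hbound⟩ hmem

end
end

section
/- (MIMO Rank Ratio Inequality for BC) Consider the k-user MISO BC with hybrid CSIT and any fixed linear coding strategy of block length n with precoding matrices V_1^n,…,V_k^n. Fix S ⊆ {1,…,k} and let Y_j^n = G_j^n[∪_{i∈S}V_i^n]. Let i_1,…,i_{j+1} be distinct receiver indices, where 1 ≤ j ≤ k−1, such that receivers i_1,…,i_j all have CSIT state D. Then almost surely rank[Y_{i_1}^n; … ; Y_{i_{j+1}}^n] / (j+1) ≤ rank[Y_{i_1}^n; … ; Y_{i_j}^n] / j, where [A;B] denotes vertical concatenation. -/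
open MeasureTheory Matrix Filter Topology

noncomputable section

/-- A family in which no vector lies in the span of the preceding ones is linearly independent. -/
theorem linearIndepOn_of_notMem_span_Iio {K E ι : Type*} [Field K] [AddCommGroup E] [Module K E]
    [LinearOrder ι] (v : ι → E) (s : Finset ι)
    (h : ∀ p ∈ s, v p ∉ Submodule.span K (v '' Set.Iio p)) :
    LinearIndepOn K v (s : Set ι) := by
  induction s using Finset.induction_on_max with
  | empty => simp
  | insert a s hlt ih =>
    rw [Finset.coe_insert]
    refine (ih fun p hp => h p (Finset.mem_insert_of_mem hp)).insert fun hmem => ?_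
    refine h a (Finset.mem_insert_self a s) (Submodule.span_mono (Set.image_mono ?_) hmem)
    exact fun x hx => hlt x hx

/-- Deterministic core of the rank ratio inequality: the vectors `y (t, a)` arrive in
lexicographic order, and whenever `z t` is not in the span of the `y`'s up to time `t`, each
`y (t, a)` is outside the span of its predecessors. -/
theorem finrank_span_ratio_le {K E : Type*} [Field K] [AddCommGroup E] [Module K E]
    [FiniteDimensional K E] {n j : ℕ} (y : Fin n ×ₗ Fin j → E) (z : Fin n → E)
    (h : ∀ t a, z t ∉ Submodule.span K (y '' {p | (ofLex p).1 ≤ t}) →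
      y (toLex (t, a)) ∉ Submodule.span K (y '' Set.Iio (toLex (t, a)))) :
    j * Module.finrank K
        ↥(Submodule.span K (Set.range y) ⊔ Submodule.span K (Set.range z))
      ≤ (j + 1) * Module.finrank K (Submodule.span K (Set.range y)) := by
  classical
  set D : Finset (Fin n) :=
    Finset.univ.filter fun t => z t ∉ Submodule.span K (y '' {p | (ofLex p).1 ≤ t}) with hDdef
  set P : Finset (Fin n ×ₗ Fin j) :=
    (D ×ˢ (Finset.univ : Finset (Fin j))).map toLex.toEmbedding with hP
  have hcardP : P.card = D.card * j := by simp [hP]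
  have hli : LinearIndepOn K y (P : Set (Fin n ×ₗ Fin j)) := by
    refine linearIndepOn_of_notMem_span_Iio y P fun p hp => ?_
    obtain ⟨⟨t, a⟩, hq, rfl⟩ := Finset.mem_map.1 hp
    exact h t a (Finset.mem_filter.1 (Finset.mem_product.1 hq).1).2
  have hlower : D.card * j ≤ Module.finrank K (Submodule.span K (Set.range y)) := by
    have h1 := finrank_span_eq_card hli
    rw [← hcardP, ← Fintype.card_coe]
    refine h1.symm.le.trans (Submodule.finrank_mono (Submodule.span_mono ?_))
    rintro _ ⟨p, rfl⟩
    exact ⟨p, rfl⟩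
  have hupper : Module.finrank K
      ↥(Submodule.span K (Set.range y) ⊔ Submodule.span K (Set.range z))
      ≤ Module.finrank K (Submodule.span K (Set.range y)) + D.card := by
    have hle : Submodule.span K (Set.range y) ⊔ Submodule.span K (Set.range z) ≤
        Submodule.span K (Set.range y) ⊔ Submodule.span K (D.image z : Set E) := by
      refine sup_le le_sup_left (Submodule.span_le.2 ?_)
      rintro _ ⟨t, rfl⟩
      by_cases ht : t ∈ D
      · exact Submodule.mem_sup_right
          (Submodule.subset_span (Finset.mem_coe.2 (Finset.mem_image_of_mem z ht)))
      · refine Submodule.mem_sup_left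
          (Submodule.span_mono (Set.image_subset_range y {p | (ofLex p).1 ≤ t}) ?_)
        simpa [hDdef] using ht
    refine (Submodule.finrank_mono hle).trans
      ((Submodule.finrank_add_le_finrank_add_finrank _ _).trans ?_)
    gcongr
    exact (finrank_span_finset_le_card _).trans Finset.card_image_le
  nlinarith

/-- Membership of a measurable vector in the span of finitely many measurable vectors is a
measurable event. -/
theorem measurableSet_mem_span_image {Ω ι κ : Type*} [MeasurableSpace Ω] [Finite ι] [Fintype κ]
    (s : Set ι) {w : Ω → ι → κ → ℂ} {x : Ω → κ → ℂ}
    (hw : ∀ i, Measurable fun ω => w ω i) (hx : Measurable x) :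
    MeasurableSet {ω | x ω ∈ Submodule.span ℂ (w ω '' s)} := by
  classical
  have := Fintype.ofFinite ι
  let q : ℕ → s → ℂ := TopologicalSpace.denseSeq (s → ℂ)
  have hq : DenseRange q := TopologicalSpace.denseRange_denseSeq _
  have key : ∀ ω, x ω ∈ Submodule.span ℂ (w ω '' s) ↔
      ∀ N : ℕ, ∃ l, dist (x ω) (∑ i : s, q l i • w ω i) < 1 / ((N : ℝ) + 1) := by
    intro ω
    let L : (s → ℂ) →ₗ[ℂ] (κ → ℂ) := Fintype.linearCombination ℂ fun i : s => w ω i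
    have hL : Continuous L := L.continuous_of_finiteDimensional
    have hrange : Set.range L = (Submodule.span ℂ (w ω '' s) : Set (κ → ℂ)) := by
      rw [← LinearMap.coe_range, Fintype.range_linearCombination, Set.image_eq_range]
    have hcl : closure (Set.range (L ∘ q)) = (Submodule.span ℂ (w ω '' s) : Set (κ → ℂ)) := by
      apply subset_antisymm
      · rw [← hrange]
        exact closure_minimal (Set.range_comp_subset_range _ _)
          (hrange ▸ Submodule.closed_of_finiteDimensional _)
      · rw [← hrange]
        rw [Set.range_comp]
        exact hL.range_subset_closure_image_dense hq
    rw [← SetLike.mem_coe, ← hcl, Metric.mem_closure_range_iff_nat]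
    simp [L, Fintype.linearCombination_apply]
  simp_rw [key]
  simp only [Set.ofPred_forall, Set.ofPred_exists]
  refine MeasurableSet.iInter fun N => MeasurableSet.iUnion fun l => ?_
  exact measurableSet_lt (hx.dist (Finset.measurable_fun_sum _ fun i _ =>
    (measurable_const_smul (q l i)).comp (hw i)))
    measurable_const

/-- A measurable set in a finite product is null if its sections along one coordinate are. -/
theorem measure_pi_eq_zero_of_update {ι : Type*} [Fintype ι] [DecidableEq ι] {X : ι → Type*}
    [∀ i, MeasurableSpace (X i)] (μ : ∀ i, Measure (X i)) [∀ i, SigmaFinite (μ i)]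
    {B : Set (∀ i, X i)} (hB : MeasurableSet B) (i : ι)
    (h : ∀ g, μ i {c | Function.update g i c ∈ B} = 0) : Measure.pi μ B = 0 := by
  rw [← lintegral_indicator_one hB]
  rw [lintegral_eq_of_lmarginal_eq {i} (g := fun _ => 0) (measurable_one.indicator hB)
    measurable_const]
  · simp
  · rw [lmarginal_singleton, lmarginal_singleton]
    funext g
    have hg := lintegral_indicator_one (μ := μ i) (measurable_update g (a := i) hB)
    rw [lintegral_zero]
    exact hg.trans (h g)

/-- The channel realization `g` with the single coefficient at receiver `i`, time `t` and
antenna `r` replaced by `c`. -/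
def updateCoeff {k m n : ℕ} (g : Chan k m n) (i : Fin k) (t : Fin n) (r : Fin m) (c : ℂ) :
    Chan k m n :=
  Function.update g i (Function.update (g i) t (Function.update (g i t) r c))

theorem updateCoeff_of_ne {k m n : ℕ} (g : Chan k m n) {i i' : Fin k} {t s : Fin n} (r : Fin m)
    (c : ℂ) (h : i' ≠ i ∨ s ≠ t) : updateCoeff g i t r c i' s = g i' s := by
  unfold updateCoeff
  by_cases hi : i' = i
  · subst hi
    simp [h.resolve_left (by simp)]
  · simp [hi]

theorem updateCoeff_self {k m n : ℕ} (g : Chan k m n) (i : Fin k) (t : Fin n) (r : Fin m)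
    (c : ℂ) : updateCoeff g i t r c i t = Function.update (g i t) r c := by
  simp [updateCoeff]

theorem chanMeasure_eq_zero_of_updateCoeff {k m n : ℕ} (μ : Measure ℂ) [IsProbabilityMeasure μ]
    [NullSingletonClass μ] {B : Set (Chan k m n)} (hB : MeasurableSet B) (i : Fin k) (t : Fin n) (r : Fin m)
    (h : ∀ g, {c | updateCoeff g i t r c ∈ B}.Subsingleton) : chanMeasure k m n μ B = 0 := by
  refine measure_pi_eq_zero_of_update _ hB i fun g => ?_
  have hB₁ := measurable_update g (a := i) hB
  refine measure_pi_eq_zero_of_update _ hB₁ t fun g₁ => ?_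
  refine measure_pi_eq_zero_of_update _ (measurable_update g₁ (a := t) hB₁) r fun g₂ => ?_
  have := h (Function.update g i (Function.update g₁ t g₂))
  simp only [updateCoeff, Function.update_self, Function.update_idem] at this
  exact this.measure_zero μ

namespace Strategy

variable {k m n : ℕ} {I : Fin k → CSITState}

/-- The transmitted row of antenna `r` at time `t` in `[∪_{i ∈ S} V_i^n]`. -/
def txRow (f : Strategy k m n I) (S : Finset (Fin k)) (g : Chan k m n) (t : Fin n) (r : Fin m) :
    ((i : {x // x ∈ S}) × Fin (f.dim i.1)) → ℂ :=
  fun c => f.pre c.1.1 t g r c.2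

theorem recvS_row (f : Strategy k m n I) (S : Finset (Fin k)) (i : Fin k) (g : Chan k m n)
    (t : Fin n) : f.recvS S i g t = ∑ r, g i t r • f.txRow S g t r := by
  funext c
  simp only [recvS, _root_.blockDiag, VS, Vn, txRow, Matrix.mul_apply, Fintype.sum_prod_type,
    Finset.sum_apply, Matrix.of_apply, Pi.smul_apply, smul_eq_mul]
  rw [Finset.sum_eq_single t]
  · simp
  · intro s _ hs
    simp [hs]
  · simp

theorem measurable_txRow (f : Strategy k m n I) (S : Finset (Fin k)) (t : Fin n) (r : Fin m) :
    Measurable fun g => f.txRow S g t r :=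
  measurable_pi_lambda _ fun c => f.meas c.1.1 t r c.2

theorem measurable_recvS_row (f : Strategy k m n I) (S : Finset (Fin k)) (i : Fin k)
    (t : Fin n) : Measurable fun g => f.recvS S i g t := by
  simp_rw [recvS_row]
  refine Finset.measurable_fun_sum _ fun r _ => ?_
  have := f.measurable_txRow S t r
  fun_prop

theorem txRow_updateCoeff (f : Strategy k m n I) (S : Finset (Fin k)) (g : Chan k m n)
    {i : Fin k} (hi : I i = CSITState.D) {s t : Fin n} (hst : s ≤ t) (r : Fin m) (c : ℂ) :
    f.txRow S (updateCoeff g i t r c) s = f.txRow S g s := by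
  funext r' q
  unfold txRow
  rw [f.causal q.1.1 s (updateCoeff g i t r c) g]
  · intro i' hi' u _
    refine updateCoeff_of_ne g r c (Or.inl ?_)
    rintro rfl
    simp [hi] at hi'
  · intro i' _ u hu
    exact updateCoeff_of_ne g r c (Or.inr (Fin.ne_of_lt (lt_of_lt_of_le hu hst)))

/-- Received row of receiver `idx p.2` at time `p.1`, indexed lexicographically. -/
def lexRow (f : Strategy k m n I) (S : Finset (Fin k)) {j : ℕ} (idx : Fin j → Fin k)
    (g : Chan k m n) (p : Fin n ×ₗ Fin j) : ((i : {x // x ∈ S}) × Fin (f.dim i.1)) → ℂ :=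
  f.recvS S (idx (ofLex p).2) g (ofLex p).1

theorem lexRow_updateCoeff (f : Strategy k m n I) (S : Finset (Fin k)) {j : ℕ}
    {idx : Fin j → Fin k} (hinj : Function.Injective idx) (hD : ∀ a, I (idx a) = CSITState.D)
    (g : Chan k m n) (t : Fin n) (a : Fin j) (r : Fin m) (c : ℂ) {p : Fin n ×ₗ Fin j}
    (hp : p < toLex (t, a)) :
    f.lexRow S idx (updateCoeff g (idx a) t r c) p = f.lexRow S idx g p := by
  have hp' := Prod.Lex.lt_iff.1 hp
  simp only [ofLex_toLex] at hp'
  unfold lexRow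
  have hle : (ofLex p).1 ≤ t := by
    rcases hp' with h | h
    · exact h.le
    · exact h.1.le
  rw [recvS_row, recvS_row, f.txRow_updateCoeff S g (hD a) hle, updateCoeff_of_ne]
  rcases hp' with h | h
  · exact Or.inr h.ne
  · exact Or.inl fun he => h.2.ne (hinj he)

theorem ae_txRow_mem_span (f : Strategy k m n I) (S : Finset (Fin k)) {j : ℕ}
    {idx : Fin j → Fin k} (hinj : Function.Injective idx) (hD : ∀ a, I (idx a) = CSITState.D)
    (μ : Measure ℂ) [IsProbabilityMeasure μ] [NullSingletonClass μ] :
    ∀ᵐ g ∂ chanMeasure k m n μ, ∀ t a r,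
      f.lexRow S idx g (toLex (t, a)) ∈
        Submodule.span ℂ (f.lexRow S idx g '' Set.Iio (toLex (t, a))) →
      f.txRow S g t r ∈ Submodule.span ℂ (f.lexRow S idx g '' Set.Iio (toLex (t, a))) := by
  simp only [ae_all_iff]
  intro t a r
  have hlex : ∀ p, Measurable fun g => f.lexRow S idx g p := fun p =>
    f.measurable_recvS_row S _ _
  rw [ae_iff]
  simp only [Classical.not_imp]
  refine chanMeasure_eq_zero_of_updateCoeff μ
    ((measurableSet_mem_span_image _ hlex (hlex _)).inter
      (measurableSet_mem_span_image _ hlex (f.measurable_txRow S t r)).compl) (idx a) t r ?_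
  intro g c₁ h₁ c₂ h₂
  have himg : ∀ c, f.lexRow S idx (updateCoeff g (idx a) t r c) '' Set.Iio (toLex (t, a)) =
      f.lexRow S idx g '' Set.Iio (toLex (t, a)) := fun c =>
    Set.image_congr fun p hp => f.lexRow_updateCoeff S hinj hD g t a r c hp
  simp only [Set.mem_ofPred_eq, himg, f.txRow_updateCoeff S g (hD a) le_rfl] at h₁ h₂
  by_contra hne
  refine h₁.2 ?_
  have hsub := Submodule.sub_mem _ h₁.1 h₂.1
  have heq : f.lexRow S idx (updateCoeff g (idx a) t r c₁) (toLex (t, a)) -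
      f.lexRow S idx (updateCoeff g (idx a) t r c₂) (toLex (t, a)) =
      (c₁ - c₂) • f.txRow S g t r := by
    simp only [lexRow, recvS_row, ofLex_toLex, f.txRow_updateCoeff S g (hD a) le_rfl,
      updateCoeff_self, ← Finset.sum_sub_distrib, ← sub_smul]
    rw [Finset.sum_eq_single r]
    · simp
    · intro b _ hb
      simp [hb]
    · simp
  rw [heq] at hsub
  exact (Submodule.smul_mem_iff _ (sub_ne_zero.2 hne)).1 hsub

end Strategy

/-- **MIMO Rank Ratio Inequality for BC.** Let `Y_i^n = G_i^n [∪_{h∈S} V_h^n]`. If the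
distinct receivers `idx 0, …, idx (j-1)` all supply delayed CSIT, then almost surely
`rank[Y_{idx 0}; …; Y_{idx j}]/(j+1) ≤ rank[Y_{idx 0}; …; Y_{idx (j-1)}]/j`. -/
theorem mimo_rank_ratio_inequality (k m n : ℕ) (hkm : k ≤ m)
    (I : Fin k → CSITState) (μ : Measure ℂ) [IsProbabilityMeasure μ]
    (hac : μ ≪ (volume : Measure ℂ)) (f : Strategy k m n I)
    (S : Finset (Fin k)) (j : ℕ) (hj1 : 1 ≤ j) (hj2 : j ≤ k - 1)
    (idx : Fin (j + 1) → Fin k) (hinj : Function.Injective idx)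
    (hD : ∀ a : Fin (j + 1), (a : ℕ) < j → I (idx a) = CSITState.D) :
    ∀ᵐ g ∂ chanMeasure k m n μ,
      ((Matrix.of fun (p : Fin (j + 1) × Fin n)
            (c : (i : {x // x ∈ S}) × Fin (f.dim i.1)) =>
              f.recvS S (idx p.1) g p.2 c).rank : ℝ) / (j + 1)
        ≤ ((Matrix.of fun (p : Fin j × Fin n)
            (c : (i : {x // x ∈ S}) × Fin (f.dim i.1)) =>
              f.recvS S (idx p.1.castSucc) g p.2 c).rank : ℝ) / j := by
  have : NullSingletonClass μ := ⟨fun x => hac (measure_singleton x)⟩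
  have hDc : ∀ a : Fin j, I (idx a.castSucc) = CSITState.D := fun a => hD _ a.isLt
  have hinjc : Function.Injective fun a : Fin j => idx a.castSucc :=
    hinj.comp (Fin.castSucc_injective j)
  filter_upwards [f.ae_txRow_mem_span S hinjc hDc μ] with g hg
  have hmain := finrank_span_ratio_le (K := ℂ) (f.lexRow S (fun a : Fin j => idx a.castSucc) g)
    (f.recvS S (idx (Fin.last j)) g) fun t a hz hmem => hz <| by
      rw [Strategy.recvS_row]
      refine Submodule.sum_mem _ fun r _ => Submodule.smul_mem _ _ ?_
      refine Submodule.span_mono (Set.image_mono fun p hp => ?_) (hg t a r hmem)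
      rcases Prod.Lex.lt_iff.1 hp with h | h
      · exact h.le
      · exact h.1.le
  have hj0 : (0 : ℝ) < j := by exact_mod_cast hj1
  rw [div_le_div_iff₀ (by positivity) hj0, Matrix.rank_eq_finrank_span_row,
    Matrix.rank_eq_finrank_span_row]
  have hsub : Submodule.span ℂ (Set.range (Matrix.of fun (p : Fin (j + 1) × Fin n)
      (c : (i : {x // x ∈ S}) × Fin (f.dim i.1)) => f.recvS S (idx p.1) g p.2 c).row) ≤
      Submodule.span ℂ (Set.range (f.lexRow S (fun a : Fin j => idx a.castSucc) g)) ⊔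
        Submodule.span ℂ (Set.range (f.recvS S (idx (Fin.last j)) g)) := by
    refine Submodule.span_le.2 ?_
    rintro _ ⟨⟨a, t⟩, rfl⟩
    induction a using Fin.lastCases with
    | last => exact Submodule.mem_sup_right (Submodule.subset_span ⟨t, rfl⟩)
    | cast a => exact Submodule.mem_sup_left (Submodule.subset_span ⟨toLex (t, a), rfl⟩)
  have heq : Set.range (f.lexRow S (fun a : Fin j => idx a.castSucc) g) =
      Set.range (Matrix.of fun (p : Fin j × Fin n)
        (c : (i : {x // x ∈ S}) × Fin (f.dim i.1)) =>
          f.recvS S (idx p.1.castSucc) g p.2 c).row := by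
    ext v
    constructor
    · rintro ⟨p, rfl⟩
      exact ⟨((ofLex p).2, (ofLex p).1), rfl⟩
    · rintro ⟨⟨a, t⟩, rfl⟩
      exact ⟨toLex (t, a), rfl⟩
  have hfin := (Nat.mul_le_mul_left j (Submodule.finrank_mono hsub)).trans hmain
  rw [heq] at hfin
  rw [mul_comm, mul_comm _ ((j : ℝ) + 1)]
  exact_mod_cast hfin

end
end

section
/- (Least Alignment Lemma) Consider the k-user MISO BC with hybrid CSIT and any fixed linear coding strategy of block length n with precoding matrices V_1^n,…,V_k^n. For any S ⊆ {1,…,k}, if receiver j has CSIT state I_j = N, then for every ℓ ∈ {1,…,k}, almost surely rank[G_ℓ^n[∪_{i∈S}V_i^n]] ≤ rank[G_j^n[∪_{i∈S}V_i^n]]. -/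
open MeasureTheory Matrix Filter Topology

noncomputable section

/-- Let `F` be a measurable function on a finite product such that, through every point where `F`
does not vanish, `F` is almost everywhere nonzero along each coordinate. If `F` is nonzero
somewhere, then it is almost everywhere nonzero. -/
theorem ae_pi_ne_zero_of_slices {ι : Type*} [Fintype ι] [DecidableEq ι] {X : ι → Type*}
    [∀ i, MeasurableSpace (X i)] (ν : ∀ i, Measure (X i)) [∀ i, SigmaFinite (ν i)]
    {F : (∀ i, X i) → ℂ} (hF : Measurable F)
    (hslice : ∀ x i, F x ≠ 0 → ∀ᵐ y ∂ν i, F (Function.update x i y) ≠ 0)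
    {x : ∀ i, X i} (hx : F x ≠ 0) : ∀ᵐ y ∂Measure.pi ν, F y ≠ 0 := by
  have hA : MeasurableSet {y | F y = 0} := hF (measurableSet_singleton 0)
  have hf : Measurable ({y | F y = 0}.indicator (1 : (∀ i, X i) → ENNReal)) :=
    measurable_one.indicator hA
  have key : ∀ (s : Finset ι) (x : ∀ i, X i), F x ≠ 0 →
      lmarginal ν s ({y | F y = 0}.indicator (1 : (∀ i, X i) → ENNReal)) x = 0 := by
    intro s
    induction s using Finset.induction_on with
    | empty => intro x hx; simp [hx]
    | insert i s hi ih =>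
      intro x hx
      rw [lmarginal_insert _ hf hi]
      rw [lintegral_congr_ae (g := 0) ((hslice x i hx).mono fun y hy => ih _ hy)]
      simp
  have h := key Finset.univ x hx
  rw [← lintegral_eq_lmarginal_univ, lintegral_indicator_one hA] at h
  rw [ae_iff]
  simpa using h

/-- Every matrix over a field has `rank` many linearly independent rows. -/
theorem Matrix.exists_linearIndependent_submatrix_rows {K α β : Type*} [Field K] [Finite α]
    [Fintype β] (A : Matrix α β K) {q : ℕ} (hq : A.rank = q) :
    ∃ r : Fin q → α, LinearIndependent K (A.submatrix r id).row := by
  rw [rank_eq_finrank_span_row] at hq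
  subst hq
  obtain ⟨v, hv, -, hli⟩ := Submodule.exists_fun_fin_finrank_span_eq K (Set.range A.row)
  choose r hr using hv
  refine ⟨r, ?_⟩
  have hrv : (A.submatrix r id).row = v := funext hr
  rwa [hrv]

/-- Every matrix over a field has a nonsingular square submatrix of size its rank. -/
theorem Matrix.exists_submatrix_det_ne_zero {K α β : Type*} [Field K] [Finite α] [Fintype β]
    (A : Matrix α β K) :
    ∃ (r : Fin A.rank → α) (c : Fin A.rank → β), (A.submatrix r c).det ≠ 0 := by
  obtain ⟨r, hr⟩ := A.exists_linearIndependent_submatrix_rows rfl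
  have hrank : (A.submatrix r id)ᵀ.rank = A.rank := by
    rw [rank_transpose, hr.rank_matrix, Fintype.card_fin]
  obtain ⟨c, hc⟩ := (A.submatrix r id)ᵀ.exists_linearIndependent_submatrix_rows hrank
  refine ⟨r, c, ?_⟩
  rw [← det_transpose, ← isUnit_iff_ne_zero, ← isUnit_iff_isUnit_det]
  exact linearIndependent_rows_iff_isUnit.1 hc

/-- A nonzero complex polynomial is almost everywhere nonzero for an atomless measure. -/
theorem Polynomial.ae_eval_ne_zero {μ : Measure ℂ} [NullSingletonClass μ] {p : Polynomial ℂ} (hp : p ≠ 0) :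
    ∀ᵐ y ∂μ, p.eval y ≠ 0 := by
  rw [ae_iff]
  refine (p.roots.toFinset.finite_toSet.subset ?_).measure_zero μ
  intro y hy
  simpa [hp] using hy

theorem measurable_det {Ω r : Type*} [MeasurableSpace Ω] [Fintype r] [DecidableEq r]
    {M : Ω → Matrix r r ℂ} (hM : ∀ a b, Measurable fun ω => M ω a b) :
    Measurable fun ω => (M ω).det := by
  simp only [Matrix.det_apply]
  fun_prop

theorem blockDiag_mul_apply {m n : ℕ} {κ : Type*} (h : Fin n → Fin m → ℂ)
    (V : Matrix (Fin n × Fin m) κ ℂ) (t : Fin n) (c : κ) :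
    (_root_.blockDiag h * V) t c = ∑ a, h t a * V (t, a) c := by
  simp [Matrix.mul_apply, _root_.blockDiag, ite_mul, Finset.sum_ite_irrel, Fintype.sum_prod_type]

/-- A minor of `blockDiag h * V` that is nonzero for one `h₀` is nonzero for almost every `h`. -/
theorem ae_det_blockDiag_mul_ne_zero {m n : ℕ} {κ r : Type*} [Fintype r] [DecidableEq r]
    (μ : Measure ℂ) [SigmaFinite μ] [NullSingletonClass μ] (V : Matrix (Fin n × Fin m) κ ℂ)
    (rows : r → Fin n) (cols : r → κ) {h₀ : Fin n → Fin m → ℂ}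
    (h₀V : ((_root_.blockDiag h₀ * V).submatrix rows cols).det ≠ 0) :
    ∀ᵐ h ∂Measure.pi fun _ : Fin n => Measure.pi fun _ : Fin m => μ,
      ((_root_.blockDiag h * V).submatrix rows cols).det ≠ 0 := by
  have hmeas : Measurable fun h : Fin n → Fin m → ℂ =>
      ((_root_.blockDiag h * V).submatrix rows cols).det := by
    refine measurable_det fun a b => ?_
    simp only [Matrix.submatrix_apply, blockDiag_mul_apply]
    fun_prop
  refine ae_pi_ne_zero_of_slices (fun _ => Measure.pi fun _ : Fin m => μ) hmeas ?_ h₀V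
  intro h t ht
  have hmeas' : Measurable fun v : Fin m → ℂ =>
      ((blockDiag (Function.update h t v) * V).submatrix rows cols).det :=
    hmeas.comp (measurable_update h)
  refine ae_pi_ne_zero_of_slices (fun _ => μ) hmeas' ?_ (x := h t) (by simpa using ht)
  intro v a hv
  let p : Polynomial ℂ := Matrix.det (Matrix.of fun i j =>
    ∑ b, (if rows i = t ∧ b = a then Polynomial.X
      else Polynomial.C (Function.update h t v (rows i) b)) *
      Polynomial.C (V (rows i, b) (cols j)))
  have hp : ∀ y, p.eval y =
      ((blockDiag (Function.update h t (Function.update v a y)) * V).submatrix rows cols).det := by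
    intro y
    rw [← Polynomial.coe_evalRingHom, RingHom.map_det]
    congr 1
    ext i j
    simp only [RingHom.mapMatrix_apply, Matrix.map_apply, Matrix.of_apply,
      Matrix.submatrix_apply, blockDiag_mul_apply, Polynomial.coe_evalRingHom,
      Polynomial.eval_finsetSum, Polynomial.eval_mul, Polynomial.eval_C]
    refine Finset.sum_congr rfl fun b _ => ?_
    congr 1
    by_cases h1 : rows i = t
    · by_cases h2 : b = a
      · subst h2; simp [h1]
      · simp [h1, h2]
    · simp [h1]
  have hp0 : p ≠ 0 := by
    intro h0
    apply hv
    simpa [h0] using (hp (v a)).symm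
  filter_upwards [Polynomial.ae_eval_ne_zero hp0] with y hy
  rwa [hp] at hy

/-- **Least Alignment Lemma.** If receiver `j` supplies no CSIT, then for any linear
coding strategy, any `S` and every receiver `ℓ`, almost surely
`rank[G_ℓ^n[∪_{i∈S}V_i^n]] ≤ rank[G_j^n[∪_{i∈S}V_i^n]]`. -/
theorem least_alignment_lemma (k m n : ℕ) (hkm : k ≤ m)
    (I : Fin k → CSITState) (μ : Measure ℂ) [IsProbabilityMeasure μ]
    (hac : μ ≪ (volume : Measure ℂ)) (f : Strategy k m n I)
    (S : Finset (Fin k)) (j : Fin k) (hjN : I j = CSITState.N) :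
    ∀ ℓ : Fin k, ∀ᵐ g ∂ chanMeasure k m n μ,
      (f.recvS S ℓ g).rank ≤ (f.recvS S j g).rank := by
  intro ℓ
  rcases eq_or_ne ℓ j with rfl | hℓ
  · simp
  have : NullSingletonClass μ := ⟨fun x => hac (measure_singleton x)⟩
  have hVS : ∀ (g : Chan k m n) h, f.VS S (Function.update g j h) = f.VS S g := by
    intro g h
    ext r c
    have := f.causal c.1.1 r.1 (Function.update g j h) g
      (fun i hi s _ => by rw [Function.update_of_ne]; rintro rfl; simp [hjN] at hi)
      (fun i hi s _ => by rw [Function.update_of_ne]; rintro rfl; simp [hjN] at hi)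
    simp [Strategy.VS, Strategy.Vn, this]
  have hmeas : ∀ (i : Fin k) (q : ℕ) (rows : Fin q → Fin n)
      (cols : Fin q → (i : {x // x ∈ S}) × Fin (f.dim i.1)),
      Measurable fun g => ((f.recvS S i g).submatrix rows cols).det := by
    intro i q rows cols
    refine measurable_det fun a b => ?_
    simp only [Matrix.submatrix_apply, Strategy.recvS, blockDiag_mul_apply]
    refine Finset.measurable_sum _ fun c _ => Measurable.mul (by fun_prop) ?_
    simpa [Strategy.VS, Strategy.Vn] using f.meas _ _ _ _
  have hminor : ∀ (q : ℕ) (rows : Fin q → Fin n)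
      (cols : Fin q → (i : {x // x ∈ S}) × Fin (f.dim i.1)),
      ∀ᵐ g ∂chanMeasure k m n μ, ((f.recvS S ℓ g).submatrix rows cols).det ≠ 0 →
        ((f.recvS S j g).submatrix rows cols).det ≠ 0 := by
    intro q rows cols
    set A : Set (Chan k m n) := {g | ((f.recvS S ℓ g).submatrix rows cols).det ≠ 0 ∧
      ((f.recvS S j g).submatrix rows cols).det = 0} with hA_def
    have hA : MeasurableSet A :=
      ((hmeas ℓ q rows cols) (measurableSet_singleton 0).compl).inter
        ((hmeas j q rows cols) (measurableSet_singleton 0))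
    suffices chanMeasure k m n μ A = 0 by
      rw [ae_iff]
      simpa [hA_def] using this
    have hf : Measurable (A.indicator (1 : Chan k m n → ENNReal)) := measurable_one.indicator hA
    rw [← lintegral_indicator_one hA, chanMeasure, lintegral_eq_lmarginal_univ (0 : Chan k m n),
      lmarginal_erase' _ hf (Finset.mem_univ j)]
    have hzero : (fun g : Chan k m n => ∫⁻ h, A.indicator (1 : Chan k m n → ENNReal)
        (Function.update g j h) ∂(Measure.pi fun _ : Fin n => Measure.pi fun _ : Fin m => μ))
        = 0 := by
      funext g
      have hae : ∀ᵐ h ∂(Measure.pi fun _ : Fin n => Measure.pi fun _ : Fin m => μ),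
          Function.update g j h ∉ A := by
        by_cases hg : ((f.recvS S ℓ g).submatrix rows cols).det = 0
        · refine Eventually.of_forall fun h hh => hh.1 ?_
          simpa only [Strategy.recvS, hVS, Function.update_of_ne hℓ] using hg
        · filter_upwards [ae_det_blockDiag_mul_ne_zero μ (f.VS S g) rows cols hg] with h hh hh'
          apply hh
          simpa only [Strategy.recvS, hVS, Function.update_self] using hh'.2
      rw [lintegral_congr_ae (g := 0) (hae.mono fun h hh => Set.indicator_of_notMem hh _)]
      simp
    rw [hzero]
    simp [lmarginal]
  have hall : ∀ᵐ g ∂chanMeasure k m n μ, ∀ (q : ℕ) (rows : Fin q → Fin n)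
      (cols : Fin q → (i : {x // x ∈ S}) × Fin (f.dim i.1)),
      ((f.recvS S ℓ g).submatrix rows cols).det ≠ 0 →
        ((f.recvS S j g).submatrix rows cols).det ≠ 0 := by
    simpa only [ae_all_iff] using hminor
  filter_upwards [hall] with g hg
  obtain ⟨rows, cols, hdet⟩ := (f.recvS S ℓ g).exists_submatrix_det_ne_zero
  have h := Matrix.rank_of_det_ne_zero (hg _ rows cols hdet)
  rw [Fintype.card_fin] at h
  exact h.symm.le.trans (Matrix.rank_submatrix_le _ _ _)

end
end

section
/- For the k-user MISO BC with hybrid CSIT, any fixed linear coding strategy of block length n, any S ⊆ {1,…,k}, any ℓ ∈ S, and any j ∉ S with CSIT state I_j = D, almost surely rank[G_ℓ^n[∪_{i∈S}V_i^n]] − |𝒯₂| ≤ rank[G_j^n[∪_{i∈S}V_i^n]], where |𝒯₂| denotes the (random) cardinality of 𝒯₂. -/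
open MeasureTheory Matrix Filter Topology

noncomputable section

namespace Strategy

variable {k m n : ℕ} {I : Fin k → CSITState}

/-- `𝒯₁`: the time slots `t` at which the dimension of the received signal
`G_ℓ^t[∪_{i∈S}V_i^t]` at receiver `ℓ` increases (by one). -/
def T1 (f : Strategy k m n I) (S : Finset (Fin k)) (ℓ : Fin k) (g : Chan k m n) :
    Set (Fin n) :=
  {t | (f.recvUpTo S ℓ g ((t : ℕ) + 1)).rank = (f.recvUpTo S ℓ g (t : ℕ)).rank + 1}

/-- `𝒯₂`: the time slots of `𝒯₁` at which, moreover, the received row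
`g_ℓ(t)·[∪_{i∈S}V_i(t)]` already lies in the row span of `G_j^{t-1}[∪_{i∈S}V_i^{t-1}]`. -/
def T2 (f : Strategy k m n I) (S : Finset (Fin k)) (ℓ j : Fin k) (g : Chan k m n) :
    Set (Fin n) :=
  {t | t ∈ f.T1 S ℓ g ∧
    (fun c => f.recvS S ℓ g t c) ∈
      Submodule.span ℂ (Set.range fun s : Fin n => fun c => f.recvUpTo S j g (t : ℕ) s c)}

end Strategy

/-- A measurable set is null for a product measure as soon as all its slices in one fixed
coordinate direction are null. -/
theorem pi_eq_zero_of_update {ι : Type*} [Fintype ι] [DecidableEq ι] {X : ι → Type*}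
    [∀ i, MeasurableSpace (X i)] (ν : ∀ i, Measure (X i)) [∀ i, SigmaFinite (ν i)]
    {B : Set (∀ i, X i)} (hB : MeasurableSet B) (i : ι)
    (h : ∀ x, ν i {y | Function.update x i y ∈ B} = 0) : Measure.pi ν B = 0 := by
  have hf : Measurable (B.indicator fun _ => (1 : ENNReal)) := measurable_const.indicator hB
  have hslice : (fun x : ∀ i, X i =>
      ∫⁻ y, B.indicator (fun _ => (1 : ENNReal)) (Function.update x i y) ∂ν i) = 0 := by
    funext x
    have hm : MeasurableSet {y | Function.update x i y ∈ B} := measurable_update x hB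
    have he : (fun y => B.indicator (fun _ => (1 : ENNReal)) (Function.update x i y))
        = {y | Function.update x i y ∈ B}.indicator fun _ => 1 := by
      funext y
      rfl
    simp [he, lintegral_indicator hm, h x]
  rw [← lintegral_indicator_one hB]
  rcases isEmpty_or_nonempty (∀ i, X i) with hX | ⟨⟨x⟩⟩
  · simp
  · change ∫⁻ x, B.indicator (fun _ => (1 : ENNReal)) x ∂Measure.pi ν = 0
    rw [lintegral_eq_lmarginal_univ x, lmarginal_erase' _ hf (Finset.mem_univ i), hslice]
    simp [lmarginal]

/-- The relation "`v` lies in the span of the finite family `w`" is measurable. -/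
theorem measurableSet_mem_span {ι κ : Type*} [Fintype ι] [Fintype κ] :
    MeasurableSet {p : (κ → ℂ) × (ι → κ → ℂ) | p.1 ∈ Submodule.span ℂ (Set.range p.2)} := by
  have hF : Continuous fun q : (ι → ℂ) × (ι → κ → ℂ) => (∑ s, q.1 s • q.2 s, q.2) := by
    fun_prop
  have he : {p : (κ → ℂ) × (ι → κ → ℂ) | p.1 ∈ Submodule.span ℂ (Set.range p.2)}
      = (fun q : (ι → ℂ) × (ι → κ → ℂ) => (∑ s, q.1 s • q.2 s, q.2)) '' Set.univ := by
    ext ⟨v, w⟩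
    simp only [Set.mem_ofPred_eq, Submodule.mem_span_range_iff_exists_fun, Set.image_univ,
      Set.mem_range, Prod.exists, Prod.mk.injEq]
    exact ⟨fun ⟨c, hc⟩ => ⟨c, w, hc, rfl⟩, fun ⟨c, _, hc, hw⟩ => ⟨c, hw ▸ hc⟩⟩
  obtain ⟨K, hK, hKU⟩ := isSigmaCompact_univ.image hF
  rw [he, ← hKU]
  exact .iUnion fun i => (hK i).isClosed.measurableSet

/-- The span of the first `t` members of a finite sequence of vectors. -/
def spanUpTo {n : ℕ} {E : Type*} [AddCommGroup E] [Module ℂ E] (w : Fin n → E) (t : ℕ) :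
    Submodule ℂ E :=
  Submodule.span ℂ (Set.range fun s : Fin n => if (s : ℕ) < t then w s else 0)

theorem mem_spanUpTo {n : ℕ} {E : Type*} [AddCommGroup E] [Module ℂ E] (w : Fin n → E)
    {s : Fin n} {t : ℕ} (h : (s : ℕ) < t) : w s ∈ spanUpTo w t :=
  Submodule.subset_span ⟨s, by simp [h]⟩

theorem spanUpTo_zero {n : ℕ} {E : Type*} [AddCommGroup E] [Module ℂ E] (w : Fin n → E) :
    spanUpTo w 0 = ⊥ := by
  simp [spanUpTo, Submodule.span_eq_bot]

theorem spanUpTo_succ {n : ℕ} {E : Type*} [AddCommGroup E] [Module ℂ E] (w : Fin n → E)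
    (t : Fin n) : spanUpTo w ((t : ℕ) + 1) = spanUpTo w t ⊔ Submodule.span ℂ {w t} := by
  apply le_antisymm
  · refine Submodule.span_le.2 ?_
    rintro _ ⟨s, rfl⟩
    dsimp only
    split_ifs with h
    · rcases Nat.lt_succ_iff_lt_or_eq.1 h with h | h
      · exact Submodule.mem_sup_left (mem_spanUpTo w h)
      · rw [Fin.ext h]
        exact Submodule.mem_sup_right (Submodule.mem_span_singleton_self _)
    · exact Submodule.zero_mem _
  · refine sup_le (Submodule.span_le.2 ?_) ?_
    · rintro _ ⟨s, rfl⟩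
      dsimp only
      split_ifs with h
      · exact mem_spanUpTo w (Nat.lt_succ_of_lt h)
      · exact Submodule.zero_mem _
    · rw [Submodule.span_singleton_le_iff_mem]
      exact mem_spanUpTo w (Nat.lt_succ_self _)

theorem finrank_spanUpTo_succ {n : ℕ} {E : Type*} [AddCommGroup E] [Module ℂ E]
    [FiniteDimensional ℂ E] (w : Fin n → E) (t : Fin n) (h : w t ∉ spanUpTo w t) :
    Module.finrank ℂ (spanUpTo w ((t : ℕ) + 1)) = Module.finrank ℂ (spanUpTo w t) + 1 := by
  have hne : w t ≠ 0 := fun h0 => h (h0 ▸ Submodule.zero_mem _)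
  have := Submodule.finrank_sup_add_finrank_inf_eq (spanUpTo w t) (Submodule.span ℂ {w t})
  rw [((Submodule.disjoint_span_singleton' hne).2 h).eq_bot, finrank_bot,
    finrank_span_singleton hne, add_zero] at this
  rw [spanUpTo_succ, this]

open Classical in
/-- The dimension of the span of the first `t` vectors is the number of innovative ones. -/
theorem finrank_spanUpTo {n : ℕ} {E : Type*} [AddCommGroup E] [Module ℂ E]
    [FiniteDimensional ℂ E] (w : Fin n → E) {t : ℕ} (ht : t ≤ n) :
    Module.finrank ℂ (spanUpTo w t)
      = (Finset.univ.filter fun s : Fin n => (s : ℕ) < t ∧ w s ∉ spanUpTo w s).card := by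
  induction t with
  | zero => simp [spanUpTo_zero]
  | succ t ih =>
    let u : Fin n := ⟨t, ht⟩
    by_cases h : w u ∈ spanUpTo w t
    · have h1 : spanUpTo w (t + 1) = spanUpTo w t :=
        (spanUpTo_succ w u).trans (by simpa [u] using h)
      rw [h1, ih (by omega)]
      congr 1
      ext s
      simp only [Finset.mem_filter, Finset.mem_univ, true_and]
      refine ⟨fun hs => ⟨by omega, hs.2⟩, fun hs => ⟨?_, hs.2⟩⟩
      by_contra hlt
      have hsu : s = u := Fin.ext (by dsimp only [u]; omega)
      exact hs.2 (hsu ▸ h)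
    · rw [finrank_spanUpTo_succ w u h, ih (by omega), ← Finset.card_insert_of_notMem (a := u)]
      · congr 1
        ext s
        simp only [Finset.mem_insert, Finset.mem_filter, Finset.mem_univ, true_and]
        constructor
        · rintro (rfl | hs)
          · exact ⟨Nat.lt_succ_self _, h⟩
          · exact ⟨by omega, hs.2⟩
        · rintro ⟨hs, hs'⟩
          rcases Nat.lt_succ_iff_lt_or_eq.1 hs with hs | hs
          · exact .inr ⟨hs, hs'⟩
          · exact .inl (Fin.ext hs)
      · simp [u]

theorem finrank_spanUpTo_eq_ncard {n : ℕ} {E : Type*} [AddCommGroup E] [Module ℂ E]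
    [FiniteDimensional ℂ E] (w : Fin n → E) :
    Module.finrank ℂ (spanUpTo w n) = {t : Fin n | w t ∉ spanUpTo w t}.ncard := by
  classical
  rw [finrank_spanUpTo w le_rfl, ← Set.ncard_coe_finset]
  congr 1
  ext s
  simp

namespace Strategy

variable {k m n : ℕ} {I : Fin k → CSITState}

/-- The row of `[∪_{i ∈ S} V_i(t)]` belonging to antenna `a`. -/
def antennaRow (f : Strategy k m n I) (S : Finset (Fin k)) (t : Fin n) (a : Fin m)
    (g : Chan k m n) : (i : {x // x ∈ S}) × Fin (f.dim i.1) → ℂ :=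
  fun c => f.pre c.1.1 t g a c.2

/-- The row received by receiver `j` at time `t`. -/
def recvRow (f : Strategy k m n I) (S : Finset (Fin k)) (j : Fin k) (g : Chan k m n)
    (t : Fin n) : (i : {x // x ∈ S}) × Fin (f.dim i.1) → ℂ :=
  ∑ a, g j t a • f.antennaRow S t a g

theorem recvS_apply (f : Strategy k m n I) (S : Finset (Fin k)) (j : Fin k) (g : Chan k m n)
    (t : Fin n) (c : (i : {x // x ∈ S}) × Fin (f.dim i.1)) :
    f.recvS S j g t c = f.recvRow S j g t c := by
  simp only [recvS, _root_.blockDiag, VS, Vn, Matrix.mul_apply, Matrix.of_apply, ite_mul,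
    zero_mul, Fintype.sum_prod_type, recvRow, antennaRow, Finset.sum_apply, Pi.smul_apply,
    smul_eq_mul]
  rw [Finset.sum_eq_single t]
  · exact Finset.sum_congr rfl fun a _ => if_pos rfl
  · exact fun s _ hs => Finset.sum_eq_zero fun a _ => if_neg hs
  · exact fun h => absurd (Finset.mem_univ t) h

theorem recvUpTo_row (f : Strategy k m n I) (S : Finset (Fin k)) (j : Fin k) (g : Chan k m n)
    (t : ℕ) (s : Fin n) :
    (fun c => f.recvUpTo S j g t s c) = if (s : ℕ) < t then f.recvRow S j g s else 0 := by
  funext c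
  simp only [recvUpTo, Matrix.of_apply, recvS_apply]
  split_ifs <;> rfl

theorem span_recvUpTo (f : Strategy k m n I) (S : Finset (Fin k)) (j : Fin k)
    (g : Chan k m n) (t : ℕ) :
    Submodule.span ℂ (Set.range fun s : Fin n => fun c => f.recvUpTo S j g t s c)
      = spanUpTo (f.recvRow S j g) t := by
  simp only [recvUpTo_row, spanUpTo]

theorem rank_recvUpTo (f : Strategy k m n I) (S : Finset (Fin k)) (j : Fin k)
    (g : Chan k m n) (t : ℕ) :
    (f.recvUpTo S j g t).rank = Module.finrank ℂ (spanUpTo (f.recvRow S j g) t) := by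
  rw [Matrix.rank_eq_finrank_span_row, ← span_recvUpTo]
  rfl

theorem rank_recvS_s8 (f : Strategy k m n I) (S : Finset (Fin k)) (j : Fin k) (g : Chan k m n) :
    (f.recvS S j g).rank
      = {t : Fin n | f.recvRow S j g t ∉ spanUpTo (f.recvRow S j g) t}.ncard := by
  rw [← finrank_spanUpTo_eq_ncard, ← rank_recvUpTo]
  congr 1
  ext s c
  simp [recvUpTo]

theorem recvRow_eq (f : Strategy k m n I) (S : Finset (Fin k)) (j : Fin k) (g : Chan k m n)
    (t : Fin n) : f.recvRow S j g t = ∑ a, g j t a • f.antennaRow S t a g :=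
  rfl

theorem measurable_antennaRow (f : Strategy k m n I) (S : Finset (Fin k)) (t : Fin n)
    (a : Fin m) : Measurable (f.antennaRow S t a) :=
  measurable_pi_lambda _ fun c => f.meas c.1.1 t a c.2

theorem measurable_recvRow (f : Strategy k m n I) (S : Finset (Fin k)) (j : Fin k)
    (t : Fin n) : Measurable fun g => f.recvRow S j g t :=
  Finset.measurable_sum _ fun a _ =>
    Measurable.smul (f := fun g : Chan k m n => g j t a) (by fun_prop)
      (f.measurable_antennaRow S t a)

theorem measurableSet_mem_spanUpTo (f : Strategy k m n I) (S : Finset (Fin k)) (j : Fin k)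
    (t : ℕ) {v : Chan k m n → (i : {x // x ∈ S}) × Fin (f.dim i.1) → ℂ} (hv : Measurable v) :
    MeasurableSet {g | v g ∈ spanUpTo (f.recvRow S j g) t} := by
  have hw : Measurable fun (g : Chan k m n) (s : Fin n) =>
      if (s : ℕ) < t then f.recvRow S j g s else 0 := by
    refine measurable_pi_lambda _ fun s => ?_
    split_ifs
    · exact f.measurable_recvRow S j s
    · exact measurable_const
  exact (hv.prodMk hw) measurableSet_mem_span

/-- Precoders up to time `t` do not depend on the time-`t` channel of a receiver with
delayed CSIT. -/
theorem pre_update (f : Strategy k m n I) {j : Fin k} (hjD : I j = CSITState.D) (t : Fin n)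
    (g : Chan k m n) (x : Fin m → ℂ) (i : Fin k) {s : Fin n} (hs : s ≤ t) :
    f.pre i s (Function.update g j (Function.update (g j) t x)) = f.pre i s g := by
  apply f.causal
  · intro i' hi' s' _
    have : i' ≠ j := by
      rintro rfl
      simp [hjD] at hi'
    simp [this]
  · intro i' _ s' hs'
    have hst : s' ≠ t := (lt_of_lt_of_le (Fin.lt_def.2 hs') hs).ne
    by_cases h : i' = j
    · subst h
      simp [hst]
    · simp [h]

theorem antennaRow_update (f : Strategy k m n I) (S : Finset (Fin k)) {j : Fin k}
    (hjD : I j = CSITState.D) (t : Fin n) (g : Chan k m n) (x : Fin m → ℂ) (a : Fin m)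
    {s : Fin n} (hs : s ≤ t) :
    f.antennaRow S s a (Function.update g j (Function.update (g j) t x))
      = f.antennaRow S s a g := by
  funext c
  simp only [antennaRow, f.pre_update hjD t g x _ hs]

theorem spanUpTo_recvRow_update (f : Strategy k m n I) (S : Finset (Fin k)) {j : Fin k}
    (hjD : I j = CSITState.D) (t : Fin n) (g : Chan k m n) (x : Fin m → ℂ) :
    spanUpTo (f.recvRow S j (Function.update g j (Function.update (g j) t x))) t
      = spanUpTo (f.recvRow S j g) t := by
  unfold spanUpTo
  congr 2
  funext s
  split_ifs with h
  · simp only [recvRow, f.antennaRow_update S hjD t g x _ (Fin.lt_def.2 h).le, Function.update_self,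
      Function.update_of_ne (Fin.lt_def.2 h).ne]
  · rfl

/-- Almost surely, if some antenna transmits something at time `t` that is new to a receiver
with delayed CSIT, then the signal received there at time `t` is new as well. -/
theorem ae_recvRow_notMem_spanUpTo (f : Strategy k m n I) (μ : Measure ℂ)
    [IsProbabilityMeasure μ] [NullSingletonClass μ] (S : Finset (Fin k)) {j : Fin k}
    (hjD : I j = CSITState.D) (t : Fin n) (a : Fin m) :
    ∀ᵐ g ∂chanMeasure k m n μ, f.antennaRow S t a g ∉ spanUpTo (f.recvRow S j g) t →
      f.recvRow S j g t ∉ spanUpTo (f.recvRow S j g) t := by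
  let B : Set (Chan k m n) := {g | f.antennaRow S t a g ∈ spanUpTo (f.recvRow S j g) t}ᶜ ∩
    {g | f.recvRow S j g t ∈ spanUpTo (f.recvRow S j g) t}
  have hB : MeasurableSet B :=
    (f.measurableSet_mem_spanUpTo S j t (f.measurable_antennaRow S t a)).compl.inter
      (f.measurableSet_mem_spanUpTo S j t (f.measurable_recvRow S j t))
  suffices h : chanMeasure k m n μ B = 0 by
    filter_upwards [measure_eq_zero_iff_ae_notMem.1 h] with g hg h1 h2
    exact hg ⟨h1, h2⟩
  refine pi_eq_zero_of_update _ hB j fun g => ?_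
  have hB1 := measurable_update g (a := j) hB
  refine pi_eq_zero_of_update _ hB1 t fun γ => ?_
  have hB2 := measurable_update γ (a := t) hB1
  refine pi_eq_zero_of_update _ hB2 a fun x => Set.Subsingleton.measure_zero ?_ μ
  rintro y ⟨hy, hy'⟩ z ⟨hz, hz'⟩
  by_contra hyz
  let g₀ : Chan k m n := Function.update g j γ
  have hg (x : Fin m → ℂ) : Function.update g j (Function.update γ t x)
      = Function.update g₀ j (Function.update (g₀ j) t x) := by
    simp [g₀]
  simp only [Set.mem_compl_iff, Set.mem_ofPred_eq, hg, f.recvRow_eq S j _ t,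
    f.spanUpTo_recvRow_update S hjD, f.antennaRow_update S hjD t _ _ _ le_rfl, Function.update_self]
    at hy hy' hz'
  have hsub := Submodule.sub_mem _ hy' hz'
  rw [← Finset.sum_sub_distrib, Finset.sum_eq_single a] at hsub
  · rw [Function.update_self, Function.update_self, ← sub_smul] at hsub
    exact hy ((Submodule.smul_mem_iff _ (sub_ne_zero.2 hyz)).1 hsub)
  · intro b _ hb
    simp [hb]
  · simp

end Strategy

/-- **Lemma 8.** For any linear coding strategy, any `S`, `ℓ ∈ S` and `j ∉ S` with
delayed CSIT, almost surely `rank[G_ℓ^n[∪_{i∈S}V_i^n]] − |𝒯₂| ≤ rank[G_j^n[∪_{i∈S}V_i^n]]`. -/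
theorem rank_minus_T2_le (k m n : ℕ) (hkm : k ≤ m)
    (I : Fin k → CSITState) (μ : Measure ℂ) [IsProbabilityMeasure μ]
    (hac : μ ≪ (volume : Measure ℂ)) (f : Strategy k m n I)
    (S : Finset (Fin k)) (ℓ : Fin k) (hℓ : ℓ ∈ S)
    (j : Fin k) (hj : j ∉ S) (hjD : I j = CSITState.D) :
    ∀ᵐ g ∂ chanMeasure k m n μ,
      ((f.recvS S ℓ g).rank : ℝ) - ((f.T2 S ℓ j g).ncard : ℝ)
        ≤ ((f.recvS S j g).rank : ℝ) := by
  have : NullSingletonClass μ := ⟨fun x => hac (measure_singleton x)⟩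
  have hae : ∀ᵐ g ∂chanMeasure k m n μ, ∀ (t : Fin n) (a : Fin m),
      f.antennaRow S t a g ∉ spanUpTo (f.recvRow S j g) t →
      f.recvRow S j g t ∉ spanUpTo (f.recvRow S j g) t :=
    ae_all_iff.2 fun t => ae_all_iff.2 fun a => f.ae_recvRow_notMem_spanUpTo μ S hjD t a
  filter_upwards [hae] with g hg
  rw [sub_le_iff_le_add, f.rank_recvS_s8 S ℓ, f.rank_recvS_s8 S j]
  norm_cast
  refine (Set.ncard_le_ncard ?_ (Set.toFinite _)).trans (Set.ncard_union_le _ _)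
  intro t ht
  by_cases hmem : f.recvRow S ℓ g t ∈ spanUpTo (f.recvRow S j g) t
  · right
    refine ⟨?_, ?_⟩
    · change (f.recvUpTo S ℓ g ((t : ℕ) + 1)).rank = (f.recvUpTo S ℓ g (t : ℕ)).rank + 1
      rw [f.rank_recvUpTo, f.rank_recvUpTo]
      exact finrank_spanUpTo_succ _ t ht
    · rw [f.span_recvUpTo, funext (f.recvS_apply S ℓ g t)]
      exact hmem
  · left
    by_contra hcon
    refine hmem ?_
    refine Submodule.sum_mem _ fun a _ => Submodule.smul_mem _ _ ?_
    by_contra ha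
    exact hcon (hg t a ha)

end
end

section
/- For the k-user MISO BC with hybrid CSIT, any fixed linear coding strategy of block length n, any S ⊆ {1,…,k}, any ℓ ∈ S, and any receiver index j ∉ S, the following inequality holds for every realization of the channels (deterministically): |𝒯₂| − rank[G_ℓ^n[∪_{i∈S, i≠ℓ}V_i^n]] ≤ rank[G_j^n[∪_{i∈S}V_i^n]] − rank[G_j^n[∪_{i∈S, i≠ℓ}V_i^n]], where |𝒯₂| denotes the cardinality of 𝒯₂. -/
open MeasureTheory Matrix Filter Topology

noncomputable section

/-- Vectors indexed by a finite linear order are linearly independent on a finset as soon as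
none of them lies in the span of the strictly earlier ones. -/
theorem linearIndepOn_of_notMem_span_lt {K V ι : Type*} [DivisionRing K] [AddCommGroup V]
    [Module K V] [LinearOrder ι] (v : ι → V) (T : Finset ι)
    (h : ∀ t ∈ T, v t ∉ Submodule.span K (v '' {s | s < t})) :
    LinearIndepOn K v (T : Set ι) := by
  induction T using Finset.induction_on_max with
  | empty => simp
  | insert a T ha ih =>
    rw [Finset.coe_insert]
    refine LinearIndepOn.insert (ih fun t ht => h t (Finset.mem_insert_of_mem ht)) fun hmem =>
      h a (Finset.mem_insert_self a T) ?_
    exact Submodule.span_mono (Set.image_mono fun s hs => ha s hs) hmem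

/-- The dimension lost by a subspace under a linear map is monotone in the subspace. -/
theorem finrank_add_finrank_map_le {K V V' : Type*} [DivisionRing K] [AddCommGroup V]
    [Module K V] [FiniteDimensional K V] [AddCommGroup V'] [Module K V'] (π : V →ₗ[K] V')
    {W R : Submodule K V} (hWR : W ≤ R) :
    Module.finrank K W + Module.finrank K (R.map π)
      ≤ Module.finrank K R + Module.finrank K (W.map π) := by
  have key (U : Submodule K V) : Module.finrank K (U.map π)
      + Module.finrank K (U ⊓ LinearMap.ker π : Submodule K V) = Module.finrank K U := by
    have h := LinearMap.finrank_range_add_finrank_ker (π.domRestrict U)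
    rw [LinearMap.range_domRestrict, LinearMap.ker_domRestrict,
      ← Submodule.finrank_map_subtype_eq, Submodule.map_comap_subtype] at h
    exact h
  have hle : Module.finrank K (W ⊓ LinearMap.ker π : Submodule K V)
      ≤ Module.finrank K (R ⊓ LinearMap.ker π : Submodule K V) :=
    Submodule.finrank_mono (inf_le_inf_right _ hWR)
  have hW := key W
  have hR := key R
  omega

/-- If the rows of `A` indexed by `T` are linearly independent and lie in the row span of `B`,
then passing to a family of columns costs `B` at least as much rank as it costs those rows. -/
theorem card_add_rank_submatrix_le {K m n p q : Type*} [Field K] [Fintype m] [Fintype n]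
    [Fintype p] [Fintype q] (A : Matrix m p K) (B : Matrix n p K) (e : q → p) (T : Finset m)
    (hT : LinearIndepOn K A.row (T : Set m))
    (hAB : ∀ t ∈ T, A.row t ∈ Submodule.span K (Set.range B.row)) :
    T.card + (B.submatrix id e).rank ≤ B.rank + (A.submatrix id e).rank := by
  have hWR : Submodule.span K (A.row '' T) ≤ Submodule.span K (Set.range B.row) := by
    rw [Submodule.span_le]
    rintro _ ⟨t, ht, rfl⟩
    exact hAB t ht
  have hcard : Module.finrank K (Submodule.span K (A.row '' T)) = T.card := by
    have h := finrank_span_eq_card (R := K) (b := fun t : (T : Set m) => A.row t) hT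
    rw [← Set.image_eq_range] at h
    simpa using h
  have h := finrank_add_finrank_map_le (LinearMap.funLeft K K e) hWR
  have hB : (Submodule.span K (Set.range B.row)).map (LinearMap.funLeft K K e)
      = Submodule.span K (Set.range (B.submatrix id e).row) := by
    rw [Submodule.map_span, ← Set.range_comp]
    rfl
  have hA : (Submodule.span K (A.row '' T)).map (LinearMap.funLeft K K e)
      ≤ Submodule.span K (Set.range (A.submatrix id e).row) := by
    rw [Submodule.map_span, Set.image_image]
    refine Submodule.span_mono ?_
    rintro _ ⟨t, -, rfl⟩
    exact ⟨t, rfl⟩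
  rw [hcard, hB, ← Matrix.rank_eq_finrank_span_row, ← Matrix.rank_eq_finrank_span_row] at h
  have hA' := Submodule.finrank_mono hA
  rw [← Matrix.rank_eq_finrank_span_row] at hA'
  omega

namespace Strategy

variable {k m n : ℕ} {I : Fin k → CSITState}

/-- The row span of the truncated received signal is the span of the first rows. -/
theorem span_range_row_recvUpTo (f : Strategy k m n I) (S : Finset (Fin k)) (j : Fin k)
    (g : Chan k m n) (t : ℕ) :
    Submodule.span ℂ (Set.range (f.recvUpTo S j g t).row)
      = Submodule.span ℂ ((f.recvS S j g).row '' {s | (s : ℕ) < t}) := by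
  refine le_antisymm (Submodule.span_le.2 ?_) (Submodule.span_mono ?_)
  · rintro _ ⟨s, rfl⟩
    by_cases hs : (s : ℕ) < t
    · have : (f.recvUpTo S j g t).row s = (f.recvS S j g).row s := by
        ext c
        simp [recvUpTo, Matrix.row, hs]
      rw [this]
      exact Submodule.subset_span ⟨s, hs, rfl⟩
    · have : (f.recvUpTo S j g t).row s = 0 := by
        ext c
        simp [recvUpTo, Matrix.row, hs]
      rw [this]
      exact Submodule.zero_mem _
  · rintro _ ⟨s, hs, rfl⟩
    refine ⟨s, ?_⟩
    ext c
    simp [recvUpTo, Matrix.row, show (s : ℕ) < t from hs]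

/-- At a slot of `T1` the received row is not in the span of the earlier rows. -/
theorem row_notMem_span_of_mem_T1 (f : Strategy k m n I) (S : Finset (Fin k)) (ℓ : Fin k)
    (g : Chan k m n) {t : Fin n} (ht : t ∈ f.T1 S ℓ g) :
    (f.recvS S ℓ g).row t
      ∉ Submodule.span ℂ ((f.recvS S ℓ g).row '' {s | s < t}) := by
  intro hmem
  have hset : {s : Fin n | (s : ℕ) < (t : ℕ) + 1} = insert t {s | s < t} := by
    ext s
    simp only [Set.mem_ofPred_eq, Set.mem_insert_iff, Fin.ext_iff, Fin.lt_def]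
    omega
  have hrank : (f.recvUpTo S ℓ g ((t : ℕ) + 1)).rank = (f.recvUpTo S ℓ g (t : ℕ)).rank + 1 := ht
  rw [Matrix.rank_eq_finrank_span_row, Matrix.rank_eq_finrank_span_row,
    span_range_row_recvUpTo, span_range_row_recvUpTo, hset, Set.image_insert_eq,
    Submodule.span_insert_eq_span hmem] at hrank
  exact absurd hrank (Nat.succ_ne_self _).symm

end Strategy

/-- **Lemma 9.** For any linear coding strategy, any `S`, `ℓ ∈ S` and receiver `j ∉ S`,
deterministically (for every channel realization)
`|𝒯₂| − rank[G_ℓ^n[∪_{i∈S,i≠ℓ}V_i^n]]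
  ≤ rank[G_j^n[∪_{i∈S}V_i^n]] − rank[G_j^n[∪_{i∈S,i≠ℓ}V_i^n]]`. -/
theorem T2_minus_rank_le (k m n : ℕ) (hkm : k ≤ m)
    (I : Fin k → CSITState) (f : Strategy k m n I)
    (S : Finset (Fin k)) (ℓ : Fin k) (hℓ : ℓ ∈ S) (j : Fin k) (hj : j ∉ S) :
    ∀ g : Chan k m n,
      ((f.T2 S ℓ j g).ncard : ℝ) - ((f.recvS (S.erase ℓ) ℓ g).rank : ℝ)
        ≤ ((f.recvS S j g).rank : ℝ) - ((f.recvS (S.erase ℓ) j g).rank : ℝ) := by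
  intro g
  classical
  set T : Finset (Fin n) := (f.T2 S ℓ j g).toFinset with hT
  have hmem : ∀ t ∈ T, t ∈ f.T2 S ℓ j g := fun t ht => Set.mem_toFinset.1 ht
  have h := card_add_rank_submatrix_le (f.recvS S ℓ g) (f.recvS S j g)
    (fun c : (i : {x // x ∈ S.erase ℓ}) × Fin (f.dim i.1) =>
      (⟨⟨c.1.1, Finset.mem_of_mem_erase c.1.2⟩, c.2⟩ :
        (i : {x // x ∈ S}) × Fin (f.dim i.1))) T
    (linearIndepOn_of_notMem_span_lt _ T fun t ht =>
      f.row_notMem_span_of_mem_T1 S ℓ g (hmem t ht).1)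
    (fun t ht => by
      have hspan : (f.recvS S ℓ g).row t
          ∈ Submodule.span ℂ (Set.range (f.recvUpTo S j g t).row) := (hmem t ht).2
      rw [Strategy.span_range_row_recvUpTo] at hspan
      exact Submodule.span_mono (Set.image_subset_range _ _) hspan)
  have hcols (i : Fin k) : (f.recvS S i g).submatrix id
      (fun c : (i : {x // x ∈ S.erase ℓ}) × Fin (f.dim i.1) =>
        (⟨⟨c.1.1, Finset.mem_of_mem_erase c.1.2⟩, c.2⟩ :
          (i : {x // x ∈ S}) × Fin (f.dim i.1))) = f.recvS (S.erase ℓ) i g := rfl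
  rw [hcols, hcols] at h
  rw [Set.ncard_eq_toFinset_card', ← hT, sub_le_sub_iff]
  exact_mod_cast h

end
end
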